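/- arXiv:2211.05204 — 2 statements merged into one kernel-verified Lean document; each statement's English description precedes it below -/
import Mathlib

section
/- For every prime p there exists an abelian p-group A with minimal characteristic inertia such that the square A ⊕ A does not have minimal characteristic inertia. -/
section Defs

variable {G : Type*} [AddCommGroup G]

/-- For a subgroup `X` of `G` and an endomorphism `φ` of `G`, `hatImage X φ` is the image
of `φ(X)` in the quotient `G ⧸ X`, i.e. the subgroup `(φ(X) + X)/X`. -/
def hatImage (X : AddSubgroup G) (φ : G →+ G) : AddSubgroup (G ⧸ X) :=
  (AddSubgroup.map φ X).map (QuotientAddGroup.mk' X)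

/-- `X` is fully invariant: stable under every additive endomorphism of `G`. -/
def FullyInvariantSub (X : AddSubgroup G) : Prop :=
  ∀ φ : G →+ G, AddSubgroup.map φ X ≤ X

/-- `X` is characteristic: stable under every additive automorphism of `G`. -/
def CharacteristicSub (X : AddSubgroup G) : Prop :=
  ∀ φ : G ≃+ G, AddSubgroup.map φ.toAddMonoidHom X ≤ X

/-- `X` is fully inert: `φ̂(X)` is finite for every endomorphism `φ` of `G`. -/
def FullyInertSub (X : AddSubgroup G) : Prop :=
  ∀ φ : G →+ G, Finite (hatImage X φ)

/-- `X` is characteristically inert: `φ̂(X)` is finite for every automorphism `φ` of `G`. -/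
def CharInertSub (X : AddSubgroup G) : Prop :=
  ∀ φ : G ≃+ G, Finite (hatImage X φ.toAddMonoidHom)

/-- Two subgroups are commensurable if their intersection has finite index in each of them. -/
def Commens (X Y : AddSubgroup G) : Prop :=
  ((X ⊓ Y).addSubgroupOf X).index ≠ 0 ∧ ((X ⊓ Y).addSubgroupOf Y).index ≠ 0

/-- `G` has minimal full inertia: every fully inert subgroup is commensurable with a
fully invariant subgroup. -/
def MinFullInertia (G : Type*) [AddCommGroup G] : Prop :=
  ∀ X : AddSubgroup G, FullyInertSub X → ∃ Y : AddSubgroup G, FullyInvariantSub Y ∧ Commens X Y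

/-- `G` has minimal characteristic inertia: every characteristically inert subgroup is
commensurable with a characteristic subgroup. -/
def MinCharInertia (G : Type*) [AddCommGroup G] : Prop :=
  ∀ X : AddSubgroup G, CharInertSub X → ∃ Y : AddSubgroup G, CharacteristicSub Y ∧ Commens X Y

/-- `G` is a `p`-group: every element is killed by some power of `p`. -/
def IsPGroup' (p : ℕ) (G : Type*) [AddCommGroup G] : Prop :=
  ∀ x : G, ∃ n : ℕ, p ^ n • x = 0

/-- Multiplication by `m` as an additive endomorphism of `G`. -/
def smulHom (m : ℕ) : G →+ G where
  toFun x := m • x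
  map_zero' := smul_zero m
  map_add' a b := smul_add m a b

/-- The subgroup `pⁿG`. -/
def pPowSub (p n : ℕ) : AddSubgroup G :=
  AddSubgroup.map (smulHom (p ^ n)) ⊤

/-- The subgroup `B[m] = {x ∈ B : m • x = 0}`. -/
def torSub (m : ℕ) (B : AddSubgroup G) : AddSubgroup G :=
  B ⊓ (smulHom m).ker

/-- The subgroup `mB = {m • x : x ∈ B}`. -/
def smulSub (m : ℕ) (B : AddSubgroup G) : AddSubgroup G :=
  AddSubgroup.map (smulHom m) B

/-- The `p`-height of `x` in `G`: the supremum in `ℕ∞` of the set of `n` with `x ∈ pⁿG`. -/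
noncomputable def pHeight (p : ℕ) (x : G) : ℕ∞ :=
  ⨆ n ∈ {n : ℕ | x ∈ (pPowSub p n : AddSubgroup G)}, (n : ℕ∞)

/-- `G` is transitive: any two elements with identical height sequences are connected by
an automorphism. -/
def TransitiveP (p : ℕ) (G : Type*) [AddCommGroup G] : Prop :=
  ∀ x y : G, (∀ n : ℕ, pHeight p (p ^ n • x) = pHeight p (p ^ n • y)) →
    ∃ φ : G ≃+ G, φ x = y

/-- `G` is separable: `p^ω G = ⋂ₙ pⁿG = 0`. -/
def SeparableP (p : ℕ) (G : Type*) [AddCommGroup G] : Prop :=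
  (⨅ n : ℕ, (pPowSub p n : AddSubgroup G)) = ⊥

end Defs


/-! ### Almost containment -/

section Almost

/-- `Z` is contained in `X` up to a finite set. -/
def AL {A : Type*} [AddCommGroup A] (X : AddSubgroup A) (Z : Set A) : Prop :=
  ∃ F : Set A, F.Finite ∧ ∀ z ∈ Z, ∃ f ∈ F, z - f ∈ X

variable {A : Type*} [AddCommGroup A]

theorem AL.pigeon {X : AddSubgroup A} {Z : Set A} (h : AL X Z) (z : ℕ → A)
    (hz : ∀ n, z n ∈ Z) : ∃ l k, l < k ∧ z k - z l ∈ X := by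
  obtain ⟨F, hF, h⟩ := h
  choose f hf hfX using fun n => h (z n) (hz n)
  have : Finite F := hF
  obtain ⟨a, b, hab, he⟩ := Finite.exists_ne_map_eq_of_infinite (fun n => (⟨f n, hf n⟩ : F))
  have he' : f a = f b := by simpa using he
  rcases lt_or_gt_of_ne hab with h1 | h1
  · refine ⟨a, b, h1, ?_⟩
    have := X.sub_mem (hfX b) (hfX a)
    rw [he'] at this
    simpa using this
  · refine ⟨b, a, h1, ?_⟩
    have := X.sub_mem (hfX a) (hfX b)
    rw [he'] at this
    simpa using this

theorem not_AL {X : AddSubgroup A} {Z : Set A} (h : ¬ AL X Z) (F : Set A) (hF : F.Finite) :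
    ∃ z ∈ Z, ∀ f ∈ F, z - f ∉ X := by
  by_contra hc
  push Not at hc
  exact h ⟨F, hF, hc⟩

/-- choose a sequence of pairwise incongruent elements from a sequence of sets -/
theorem exists_seq_incong (X : AddSubgroup A) (Z : ℕ → Set A) (h : ∀ n, ¬ AL X (Z n)) :
    ∃ z : ℕ → A, (∀ n, z n ∈ Z n) ∧ ∀ l k, l < k → z k - z l ∉ X := by
  choose g hg hgX using fun n (F : {F : Set A // F.Finite}) => not_AL (h n) F.1 F.2
  let F : ℕ → {F : Set A // F.Finite} := fun n => Nat.rec ⟨∅, Set.finite_empty⟩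
    (fun n F => ⟨insert (g n F) F.1, F.2.insert _⟩) n
  have hF : ∀ n, (F (n+1)).1 = insert (g n (F n)) (F n).1 := fun n => rfl
  have hmono : ∀ l d, g l (F l) ∈ (F (l + 1 + d)).1 := by
    intro l d
    induction d with
    | zero => rw [Nat.add_zero, hF]; exact Set.mem_insert _ _
    | succ d ih => rw [← Nat.add_assoc, hF]; exact Set.mem_insert_of_mem _ ih
  refine ⟨fun n => g n (F n), fun n => hg n _, fun l k hlk => ?_⟩
  apply hgX
  obtain ⟨d, rfl⟩ := Nat.exists_eq_add_of_le (Nat.succ_le_of_lt hlk)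
  exact hmono l d

theorem AL.of_no_seq {X : AddSubgroup A} {Z : Set A}
    (h : ∀ z : ℕ → A, (∀ n, z n ∈ Z) → ∃ l k, l < k ∧ z k - z l ∈ X) : AL X Z := by
  by_contra hc
  obtain ⟨z, hz, hX⟩ := exists_seq_incong X (fun _ => Z) (fun _ => hc)
  obtain ⟨l, k, hlk, hm⟩ := h z hz
  exact hX l k hlk hm

theorem AL.mono {X : AddSubgroup A} {Z Z' : Set A} (h : AL X Z) (hZ : Z' ⊆ Z) : AL X Z' := by
  obtain ⟨F, hF, h⟩ := h
  exact ⟨F, hF, fun z hz => h z (hZ hz)⟩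

theorem AL.reps {X : AddSubgroup A} {Z : Set A} (h : AL X Z) :
    ∃ F : Set A, F.Finite ∧ F ⊆ Z ∧ ∀ z ∈ Z, ∃ f ∈ F, z - f ∈ X := by
  classical
  obtain ⟨F, hF, h⟩ := h
  let F' := {f ∈ F | ∃ z ∈ Z, z - f ∈ X}
  have hF' : F'.Finite := hF.subset (fun f hf => hf.1)
  let r : A → A := fun f => if hf : ∃ z ∈ Z, z - f ∈ X then hf.choose else 0
  have hr : ∀ f, (∃ z ∈ Z, z - f ∈ X) → r f ∈ Z ∧ r f - f ∈ X := by
    intro f hf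
    simp only [r, dif_pos hf]
    exact hf.choose_spec
  refine ⟨r '' F', hF'.image r, ?_, ?_⟩
  · rintro _ ⟨f, hf, rfl⟩
    exact (hr f hf.2).1
  · intro z hz
    obtain ⟨f, hf, hzf⟩ := h z hz
    refine ⟨r f, ⟨f, ⟨hf, z, hz, hzf⟩, rfl⟩, ?_⟩
    have := X.sub_mem hzf (hr f ⟨z, hz, hzf⟩).2
    simpa using this

theorem AL.trans {X Y : AddSubgroup A} {Z : Set A} (h1 : AL Y Z) (h2 : AL X (Y : Set A)) :
    AL X Z := by
  obtain ⟨F, hF, h1⟩ := h1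
  obtain ⟨G, hG, h2⟩ := h2
  refine ⟨Set.image2 (· + ·) F G, hF.image2 _ hG, fun z hz => ?_⟩
  obtain ⟨f, hf, hzf⟩ := h1 z hz
  obtain ⟨g, hg, hzg⟩ := h2 _ hzf
  exact ⟨f + g, ⟨f, hf, g, hg, rfl⟩, by simpa [sub_sub] using hzg⟩

theorem AL.add {X : AddSubgroup A} {ι : Type*} {a b : ι → A} (h1 : AL X (Set.range a))
    (h2 : AL X (Set.range b)) : AL X (Set.range (fun i => a i + b i)) := by
  obtain ⟨F, hF, h1⟩ := h1
  obtain ⟨G, hG, h2⟩ := h2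
  refine ⟨Set.image2 (· + ·) F G, hF.image2 _ hG, ?_⟩
  rintro _ ⟨i, rfl⟩
  obtain ⟨f, hf, hzf⟩ := h1 _ ⟨i, rfl⟩
  obtain ⟨g, hg, hzg⟩ := h2 _ ⟨i, rfl⟩
  refine ⟨f + g, ⟨f, hf, g, hg, rfl⟩, ?_⟩
  show a i + b i - (f + g) ∈ X
  rw [add_sub_add_comm]
  exact X.add_mem hzf hzg

theorem AL.comap {A' : Type*} [AddCommGroup A'] {X : AddSubgroup A} {f : A' →+ A} {Z : Set A'}
    (h : AL X (f '' Z)) : AL (X.comap f) Z := by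
  refine AL.of_no_seq fun z hz => ?_
  obtain ⟨l, k, hlk, hm⟩ := h.pigeon (fun n => f (z n)) (fun n => ⟨_, hz n, rfl⟩)
  exact ⟨l, k, hlk, by simpa using hm⟩

theorem AL_iff_relIndex {X Z : AddSubgroup A} : AL X (Z : Set A) ↔ X.relIndex Z ≠ 0 := by
  have e : X.relIndex Z = Nat.card (Z.map (QuotientAddGroup.mk' X)) := by
    rw [← AddSubgroup.relIndex_ker, QuotientAddGroup.ker_mk']
  have e2 : X.relIndex Z ≠ 0 ↔ Finite (Z.map (QuotientAddGroup.mk' X)) := by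
    rw [e, ← Nat.pos_iff_ne_zero, Nat.card_pos_iff]
    exact ⟨fun h => h.2, fun h => ⟨⟨0⟩, h⟩⟩
  rw [e2]
  constructor
  · rintro ⟨F, hF, h⟩
    have : ((Z.map (QuotientAddGroup.mk' X) : AddSubgroup (A ⧸ X)) : Set (A ⧸ X)).Finite := by
      refine (hF.image (QuotientAddGroup.mk' X)).subset ?_
      rintro _ ⟨z, hz, rfl⟩
      obtain ⟨f, hf, hfx⟩ := h z hz
      refine ⟨f, hf, ?_⟩
      rw [← sub_eq_zero, ← map_sub]
      rw [← AddMonoidHom.mem_ker, QuotientAddGroup.ker_mk']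
      simpa using X.neg_mem hfx
    exact this
  · intro hfin
    refine AL.of_no_seq fun z hz => ?_
    obtain ⟨a, b, hab, he⟩ := Finite.exists_ne_map_eq_of_infinite
      (fun n => (⟨QuotientAddGroup.mk' X (z n), z n, hz n, rfl⟩ : Z.map (QuotientAddGroup.mk' X)))
    have he' : QuotientAddGroup.mk' X (z a) = QuotientAddGroup.mk' X (z b) := by
      simpa using he
    have key : ∀ a b, QuotientAddGroup.mk' X (z a) = QuotientAddGroup.mk' X (z b) →
        z b - z a ∈ X := by
      intro a b h
      rw [← QuotientAddGroup.ker_mk' X, AddMonoidHom.mem_ker, map_sub, h, sub_self]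
    rcases lt_or_gt_of_ne hab with h1 | h1
    · exact ⟨a, b, h1, key a b he'⟩
    · exact ⟨b, a, h1, key b a he'.symm⟩

theorem Commens_iff {X Y : AddSubgroup A} :
    Commens X Y ↔ AL Y (X : Set A) ∧ AL X (Y : Set A) := by
  rw [AL_iff_relIndex, AL_iff_relIndex]
  unfold Commens
  rw [show ((X ⊓ Y).addSubgroupOf X).index = Y.relIndex X from AddSubgroup.inf_relIndex_left X Y,
    show ((X ⊓ Y).addSubgroupOf Y).index = X.relIndex Y from AddSubgroup.inf_relIndex_right X Y]

theorem hatImage_finite_iff {X : AddSubgroup A} {φ : A →+ A} :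
    Finite (hatImage X φ) ↔ AL X (φ '' X) := by
  have : AL X (φ '' (X : Set A)) ↔ AL X ((X.map φ : AddSubgroup A) : Set A) := by
    rw [AddSubgroup.coe_map]
  rw [this, AL_iff_relIndex]
  have e : X.relIndex (X.map φ) = Nat.card (hatImage X φ) := by
    unfold hatImage
    rw [← AddSubgroup.relIndex_ker, QuotientAddGroup.ker_mk']
  rw [e, ← Nat.pos_iff_ne_zero, Nat.card_pos_iff]
  exact ⟨fun h => ⟨⟨0⟩, h⟩, fun h => h.2⟩

/-- an endomorphism is good for `X` if it maps `X` into `X` up to a finite set -/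
def Good (X : AddSubgroup A) (φ : A →+ A) : Prop := AL X (φ '' X)

theorem Good.map {X : AddSubgroup A} {φ : A →+ A} (h : Good X φ) {Z : Set A} (hZ : AL X Z) :
    AL X (φ '' Z) := by
  refine AL.of_no_seq fun z hz => ?_
  choose w hw hwz using hz
  obtain ⟨F, hF, hX⟩ := hZ
  obtain ⟨G, hG, hY⟩ := h
  have : AL X (φ '' Z) := by
    refine ⟨Set.image2 (fun f g => φ f + g) F G, hF.image2 _ hG, ?_⟩
    rintro _ ⟨z, hz, rfl⟩
    obtain ⟨f, hf, h1⟩ := hX z hz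
    obtain ⟨g, hg, h2⟩ := hY _ ⟨_, h1, rfl⟩
    refine ⟨φ f + g, ⟨f, hf, g, hg, rfl⟩, ?_⟩
    rw [map_sub] at h2
    simpa [sub_sub] using h2
  exact this.pigeon z (fun n => ⟨w n, hw n, hwz n⟩)

theorem Good.comp {X : AddSubgroup A} {φ ψ : A →+ A} (h : Good X φ) (h' : Good X ψ) :
    Good X (φ.comp ψ) := by
  have := h.map h'
  unfold Good
  convert this using 1
  ext z; simp

theorem Good.add {X : AddSubgroup A} {φ ψ : A →+ A} (h : Good X φ) (h' : Good X ψ) :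
    Good X (φ + ψ) := by
  unfold Good at *
  rw [Set.image_eq_range] at *
  exact h.add h'

theorem Good.id (X : AddSubgroup A) : Good X (AddMonoidHom.id A) :=
  ⟨{0}, Set.finite_singleton _, by rintro _ ⟨x, hx, rfl⟩; exact ⟨0, rfl, by simpa using hx⟩⟩

theorem Good.neg {X : AddSubgroup A} {φ : A →+ A} (h : Good X φ) : Good X (-φ) := by
  have h1 : Good X (-(AddMonoidHom.id A)) := 
    ⟨{0}, Set.finite_singleton _, by rintro _ ⟨x, hx, rfl⟩; exact ⟨0, rfl, by simpa using hx⟩⟩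
  have := h1.comp h
  convert this using 1
  ext a
  simp

theorem CharInertSub.good_of_sq {X : AddSubgroup A} (hX : CharInertSub X) (η : A →+ A)
    (hη : ∀ a, η (η a) = 0) : Good X η := by
  let e : A ≃+ A :=
    { toFun := fun a => a + η a
      invFun := fun a => a - η a
      left_inv := fun a => by simp [hη]
      right_inv := fun a => by simp [hη]
      map_add' := fun a b => by simp only [map_add]; abel }
  have h1 : Good X e.toAddMonoidHom := hatImage_finite_iff.1 (hX e)
  have h2 := h1.add (Good.id X).neg
  convert h2 using 1
  ext a
  simp [e]

end Almost

/-! ### Groups with a big direct summand `P^(ω)` -/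

section BigSummand

variable {P B : Type} [AddCommGroup P] [AddCommGroup B]

/-- the inclusions of `P` in `P^(ω) × B` -/
noncomputable def incl (P B : Type) [AddCommGroup P] [AddCommGroup B] (i : ℕ × ℕ) :
    P →+ (ℕ × ℕ →₀ P) × B :=
  (AddMonoidHom.inl (ℕ × ℕ →₀ P) B).comp (Finsupp.singleAddHom i)

theorem goodE {X : AddSubgroup ((ℕ × ℕ →₀ P) × B)} (hX : CharInertSub X)
    (s : (ℕ × ℕ →₀ P) →+ B) (r : B →+ (ℕ × ℕ →₀ P)) (hrs : ∀ e, r (s e) = e)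
    (θ : (ℕ × ℕ →₀ P) →+ (ℕ × ℕ →₀ P) × B) :
    Good X (θ.comp (AddMonoidHom.fst _ _)) := by
  have h1 : Good X ((AddMonoidHom.inr (ℕ × ℕ →₀ P) B).comp
      (((AddMonoidHom.snd _ _).comp θ).comp (AddMonoidHom.fst _ _))) := by
    apply hX.good_of_sq
    intro a
    simp
  have h2 : Good X ((AddMonoidHom.inr (ℕ × ℕ →₀ P) B).comp
      (s.comp (AddMonoidHom.fst _ _))) := by
    apply hX.good_of_sq
    intro a
    simp
  have h3 : Good X ((AddMonoidHom.inl (ℕ × ℕ →₀ P) B).comp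
      ((((AddMonoidHom.fst _ _).comp θ).comp r).comp (AddMonoidHom.snd _ _))) := by
    apply hX.good_of_sq
    intro a
    simp
  have h4 := (h3.comp h2).add h1
  convert h4 using 1
  ext a <;> simp [hrs]

theorem goodP {X : AddSubgroup ((ℕ × ℕ →₀ P) × B)} (hX : CharInertSub X)
    (s : (ℕ × ℕ →₀ P) →+ B) (r : B →+ (ℕ × ℕ →₀ P)) (hrs : ∀ e, r (s e) = e)
    (γ : (ℕ × ℕ →₀ P) × B →+ P) (i : ℕ × ℕ) :
    Good X ((incl P B i).comp γ) := by
  have h1 : Good X (((incl P B i).comp (γ.comp (AddMonoidHom.inr (ℕ × ℕ →₀ P) B))).comp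
      (AddMonoidHom.snd _ _)) := by
    apply hX.good_of_sq
    intro a
    simp only [incl, AddMonoidHom.comp_apply, AddMonoidHom.coe_snd, AddMonoidHom.inl_apply, map_zero]
  have h2 := goodE hX s r hrs ((incl P B i).comp (γ.comp (AddMonoidHom.inl (ℕ × ℕ →₀ P) B)))
  have h3 := h2.add h1
  convert h3 using 1
  have hγ : ∀ a, γ a = γ (a.1, 0) + γ (0, a.2) := fun a => by rw [← map_add]; simp
  refine AddMonoidHom.ext fun a => ?_
  simp only [AddMonoidHom.add_apply, AddMonoidHom.comp_apply, AddMonoidHom.coe_fst,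
    AddMonoidHom.coe_snd, AddMonoidHom.inl_apply, AddMonoidHom.inr_apply]
  rw [← map_add, ← hγ]

/-- the subgroup of `P` attached to `X` -/
noncomputable def Ysub (X : AddSubgroup ((ℕ × ℕ →₀ P) × B)) : AddSubgroup P where
  carrier := {y | AL X (Set.range fun i => incl P B i y)}
  zero_mem' := ⟨{0}, Set.finite_singleton _, by
    rintro _ ⟨i, rfl⟩; exact ⟨0, rfl, by simp⟩⟩
  add_mem' := by
    intro a b ha hb
    have := AL.add ha hb
    simpa using this
  neg_mem' := by
    rintro a ⟨F, hF, h⟩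
    refine ⟨-F, hF.neg, ?_⟩
    rintro _ ⟨i, rfl⟩
    obtain ⟨f, hf, h⟩ := h _ ⟨i, rfl⟩
    refine ⟨-f, by simpa using hf, ?_⟩
    have := X.neg_mem h
    simpa [add_comm, sub_eq_add_neg] using this

theorem mem_Ysub {X : AddSubgroup ((ℕ × ℕ →₀ P) × B)} {y : P} :
    y ∈ Ysub X ↔ AL X (Set.range fun i => incl P B i y) := Iff.rfl

theorem exists_lift (β : ℕ × ℕ → P →+ (ℕ × ℕ →₀ P) × B) :
    ∃ θ : (ℕ × ℕ →₀ P) →+ (ℕ × ℕ →₀ P) × B, ∀ i y, (θ.comp (AddMonoidHom.fst _ _))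
      (incl P B i y) = β i y :=
  ⟨Finsupp.liftAddHom β, fun i y => by simp [incl]⟩

variable {X : AddSubgroup ((ℕ × ℕ →₀ P) × B)}

theorem Ysub_inv (hX : CharInertSub X)
    (s : (ℕ × ℕ →₀ P) →+ B) (r : B →+ (ℕ × ℕ →₀ P)) (hrs : ∀ e, r (s e) = e)
    (θ : P →+ P) {y : P} (hy : y ∈ Ysub X) : θ y ∈ Ysub X := by
  obtain ⟨Θ, hΘ⟩ := exists_lift (B := B) (fun i => (incl P B i).comp θ)
  have h := (goodE hX s r hrs Θ).map hy
  rw [mem_Ysub]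
  convert h using 1
  rw [← Set.range_comp]
  congr 1
  ext1 i
  exact (hΘ i y).symm

theorem AL_W (hX : CharInertSub X)
    (s : (ℕ × ℕ →₀ P) →+ B) (r : B →+ (ℕ × ℕ →₀ P)) (hrs : ∀ e, r (s e) = e) :
    AL X {a | ∃ β : P →+ (ℕ × ℕ →₀ P) × B, ∃ y ∈ Ysub X, a = β y} := by
  classical
  refine AL.of_no_seq fun z hz => ?_
  choose β y hy hz using hz
  have : ∀ k, ∃ t t', t ≠ t' ∧ incl P B (k, t) (y k) - incl P B (k, t') (y k) ∈ X := by
    intro k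
    obtain ⟨l, m, hlm, h⟩ := (mem_Ysub.1 (hy k)).pigeon (fun t => incl P B (k, t) (y k))
      (fun t => ⟨_, rfl⟩)
    exact ⟨m, l, hlm.ne', h⟩
  choose t t' htt' hXt using this
  obtain ⟨Θ, hΘ⟩ := exists_lift (B := B) (fun i => if i.2 = t i.1 then β i.1 else 0)
  refine (goodE hX s r hrs Θ).pigeon z fun n => ⟨_, hXt n, ?_⟩
  rw [map_sub, hΘ, hΘ, hz]
  simp [(htt' n).symm]

theorem AL_X0 (hX : CharInertSub X)
    (s : (ℕ × ℕ →₀ P) →+ B) (r : B →+ (ℕ × ℕ →₀ P)) (hrs : ∀ e, r (s e) = e) :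
    AL (Ysub X) {y | incl P B (0, 0) y ∈ X} := by
  classical
  by_contra hc
  have h1 : ∀ i : ℕ, ∃ y, incl P B (i, 0) y ∈ X ∧ y ∉ Ysub X := by
    intro i
    obtain ⟨z, hz, hzY⟩ := exists_seq_incong _ (fun _ => _) (fun _ => hc)
    obtain ⟨Θ, hΘ⟩ := exists_lift (B := B) (fun j => incl P B (i, 0))
    obtain ⟨l, k, hlk, h⟩ := (goodE hX s r hrs Θ).pigeon (fun n => incl P B (i, 0) (z n))
      (fun n => ⟨_, hz n, hΘ _ _⟩)
    exact ⟨z k - z l, by simpa using h, hzY l k hlk⟩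
  choose y hyX hyY using h1
  obtain ⟨z, hz, hzX⟩ := exists_seq_incong X (fun n => Set.range fun i => incl P B i (y n))
    (fun n => hyY n)
  choose j hj using hz
  obtain ⟨Θ, hΘ⟩ := exists_lift (B := B) (fun i => incl P B (j i.1))
  obtain ⟨l, k, hlk, h⟩ := (goodE hX s r hrs Θ).pigeon z
      (fun n => ⟨_, hyX n, by rw [hΘ]; exact hj n⟩)
  exact hzX l k hlk h

theorem AL_gamma (hX : CharInertSub X)
    (s : (ℕ × ℕ →₀ P) →+ B) (r : B →+ (ℕ × ℕ →₀ P)) (hrs : ∀ e, r (s e) = e)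
    (γ : (ℕ × ℕ →₀ P) × B →+ P) : AL (Ysub X) (γ '' X) := by
  have h1 := goodP hX s r hrs γ (0, 0)
  have h2 : AL X ((incl P B (0, 0)) '' (γ '' X)) := by
    rw [← Set.image_comp]; exact h1
  exact h2.comap.trans (AL_X0 hX s r hrs)

theorem AL_U (hX : CharInertSub X)
    (s : (ℕ × ℕ →₀ P) →+ B) (r : B →+ (ℕ × ℕ →₀ P)) (hrs : ∀ e, r (s e) = e)
    (δ : ℕ → P →+ P) (hδ : ∀ γ : ℕ → ((ℕ × ℕ →₀ P) × B →+ P),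
      ∃ γ' : (ℕ × ℕ →₀ P) × B →+ P, ∀ k a, δ k (γ' a) = γ k a)
    (U : AddSubgroup ((ℕ × ℕ →₀ P) × B))
    (hU : ∀ a, (∀ γ : (ℕ × ℕ →₀ P) × B →+ P, γ a ∈ Ysub X) → a ∈ U) :
    AL U (X : Set _) := by
  by_contra hc
  obtain ⟨x, hx, hxU⟩ := exists_seq_incong _ (fun _ => _) (fun _ => hc)
  have : ∀ l k, ∃ γ : (ℕ × ℕ →₀ P) × B →+ P, l < k → γ (x k - x l) ∉ Ysub X := by
    intro l k
    by_cases hlk : l < k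
    · by_contra hc'
      push Not at hc'
      exact hxU l k hlk (hU _ fun γ => (hc' γ).2)
    · exact ⟨0, fun h => absurd h hlk⟩
  choose γ hγ using this
  obtain ⟨γ', hγ'⟩ := hδ (fun m => γ m.unpair.1 m.unpair.2)
  obtain ⟨l, k, hlk, h⟩ := (AL_gamma hX s r hrs γ').pigeon (fun n => γ' (x n))
    (fun n => ⟨_, hx n, rfl⟩)
  rw [← map_sub] at h
  have h2 := Ysub_inv hX s r hrs (δ (Nat.pair l k)) h
  rw [hγ'] at h2
  simp only [Nat.unpair_pair] at h2
  exact hγ l k hlk h2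

/-- The main reduction. -/
theorem minChar_of (s : (ℕ × ℕ →₀ P) →+ B) (r : B →+ (ℕ × ℕ →₀ P)) (hrs : ∀ e, r (s e) = e)
    (δ : ℕ → P →+ P) (hδ : ∀ γ : ℕ → ((ℕ × ℕ →₀ P) × B →+ P),
      ∃ γ' : (ℕ × ℕ →₀ P) × B →+ P, ∀ k a, δ k (γ' a) = γ k a)
    (hδP : ∀ γ : ℕ → (P →+ P), ∃ γ' : P →+ P, ∀ k a, δ k (γ' a) = γ k a)
    (p : ℕ) (htor : IsPGroup' p ((ℕ × ℕ →₀ P) × B))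
    (hA3 : ∀ Y : AddSubgroup P, FullyInvariantSub Y → ∀ (k : ℕ) (y : P), y ∈ Y →
      p ^ k • y ≠ 0 → ∀ a : (ℕ × ℕ →₀ P) × B, p ^ (k + 1) • a = 0 →
      (∀ γ : (ℕ × ℕ →₀ P) × B →+ P, γ a ∈ Y) → ∀ W : AddSubgroup ((ℕ × ℕ →₀ P) × B),
      (∀ (β : P →+ (ℕ × ℕ →₀ P) × B), ∀ y ∈ Y, β y ∈ W) → a ∈ W)
    (hA4 : ∀ φ : (ℕ × ℕ →₀ P) × B ≃+ (ℕ × ℕ →₀ P) × B, ∃ c : ℤ,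
      ∀ a : (ℕ × ℕ →₀ P) × B, (∀ γ : (ℕ × ℕ →₀ P) × B →+ P, γ a = 0) → φ a = c • a) :
    MinCharInertia ((ℕ × ℕ →₀ P) × B) := by
  intro X hX
  have hYinv : FullyInvariantSub (Ysub X) := by
    rintro θ _ ⟨y, hy, rfl⟩
    exact Ysub_inv hX s r hrs θ hy
  set Y := Ysub X with hY
  let W : AddSubgroup ((ℕ × ℕ →₀ P) × B) :=
    { carrier := {a | ∃ β : P →+ (ℕ × ℕ →₀ P) × B, ∃ y ∈ Y, a = β y}
      zero_mem' := ⟨0, 0, Y.zero_mem, by simp⟩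
      add_mem' := by
        rintro _ _ ⟨β, y, hy, rfl⟩ ⟨β', y', hy', rfl⟩
        obtain ⟨σ0, hσ0⟩ := hδP (fun k => if k = 0 then AddMonoidHom.id P else 0)
        obtain ⟨σ1, hσ1⟩ := hδP (fun k => if k = 1 then AddMonoidHom.id P else 0)
        refine ⟨β.comp (δ 0) + β'.comp (δ 1), σ0 y + σ1 y', Y.add_mem ?_ ?_, ?_⟩
        · exact hYinv σ0 ⟨y, hy, rfl⟩
        · exact hYinv σ1 ⟨y', hy', rfl⟩
        · simp [hσ0, hσ1]
      neg_mem' := by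
        rintro _ ⟨β, y, hy, rfl⟩
        exact ⟨β, -y, Y.neg_mem hy, by simp⟩ }
  let U : AddSubgroup ((ℕ × ℕ →₀ P) × B) :=
    { carrier := {a | ∀ γ : (ℕ × ℕ →₀ P) × B →+ P, γ a ∈ Y}
      zero_mem' := fun γ => by simp
      add_mem' := fun ha hb γ => by rw [map_add]; exact Y.add_mem (ha γ) (hb γ)
      neg_mem' := fun ha γ => by rw [map_neg]; exact Y.neg_mem (ha γ) }
  have hWX : AL X (W : Set _) := AL_W hX s r hrs
  have hXU : AL U (X : Set _) := AL_U hX s r hrs δ hδ U (fun a h => h)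
  have hWU : W ≤ U := by
    rintro _ ⟨β, y, hy, rfl⟩ γ
    exact hYinv (γ.comp β) ⟨y, hy, rfl⟩
  have hWmem : ∀ (β : P →+ (ℕ × ℕ →₀ P) × B), ∀ y ∈ Y, β y ∈ W :=
    fun β y hy => ⟨β, y, hy, rfl⟩
  have hUinv : ∀ (φ : (ℕ × ℕ →₀ P) × B →+ (ℕ × ℕ →₀ P) × B) a, a ∈ U → φ a ∈ U :=
    fun φ a ha γ => ha (γ.comp φ)
  refine ⟨(X ⊓ U) ⊔ W, ?_, ?_⟩
  · -- characteristic
    set X' := (X ⊓ U) ⊔ W with hX'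
    have hWX' : W ≤ X' := le_sup_right
    have hX'U : X' ≤ U := sup_le inf_le_right hWU
    rintro φ _ ⟨x, hx, rfl⟩
    by_cases hb : ∀ k : ℕ, ∃ y ∈ Y, p ^ k • y ≠ 0
    · obtain ⟨k, hk⟩ := htor x
      obtain ⟨y, hy, hyk⟩ := hb k
      apply hWX'
      refine hA3 Y hYinv k y hy hyk _ ?_ (hUinv _ _ (hX'U hx)) W hWmem
      rw [← map_nsmul, pow_succ', mul_smul, hk]
      simp
    · push Not at hb
      obtain ⟨c, hc⟩ := hA4 φ
      classical
      have hk := Nat.find_spec hb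
      have hmin := fun m => Nat.find_min hb (m := m)
      set k := Nat.find hb with hkdef
      have hH : φ (p ^ k • x) = c • (p ^ k • x) := by
        apply hc
        intro γ
        rw [map_nsmul]
        exact hk _ (hX'U hx γ)
      have h0 : p ^ k • (φ x - c • x) = 0 := by
        rw [smul_sub, ← map_nsmul, hH, smul_comm, sub_self]
      have hmemU : φ x - c • x ∈ U :=
        U.sub_mem (hUinv φ.toAddMonoidHom _ (hX'U hx)) (U.zsmul_mem (hX'U hx) c)
      have hmemX : φ x - c • x ∈ X' := by
        rcases Nat.eq_zero_or_pos k with h | h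
        · rw [h] at h0
          have : φ x - c • x = 0 := by simpa using h0
          rw [this]; exact X'.zero_mem
        · obtain ⟨m, hm⟩ := Nat.exists_eq_succ_of_ne_zero h.ne'
          have := hmin m (by omega)
          push Not at this
          obtain ⟨y, hy, hym⟩ := this
          apply hWX'
          refine hA3 Y hYinv m y hy hym _ ?_ hmemU W hWmem
          rw [← Nat.succ_eq_add_one, ← hm]; exact h0
      have := X'.add_mem hmemX (X'.zsmul_mem hx c)
      simpa using this
  · rw [Commens_iff]
    constructor
    · obtain ⟨F, hF, hFX, h⟩ := hXU.reps
      refine ⟨F, hF, fun x hx => ?_⟩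
      obtain ⟨f, hf, hxf⟩ := h x hx
      exact ⟨f, hf, AddSubgroup.mem_sup_left ⟨X.sub_mem hx (hFX hf), hxf⟩⟩
    · obtain ⟨F, hF, h⟩ := hWX
      refine ⟨F, hF, fun z hz => ?_⟩
      obtain ⟨u, hu, w, hw, rfl⟩ := AddSubgroup.mem_sup.1 hz
      obtain ⟨f, hf, hwf⟩ := h w hw
      refine ⟨f, hf, ?_⟩
      rw [add_sub_assoc]
      exact X.add_mem hu.1 hwf

end BigSummand

/-! ### The generic functional -/

section Generic

set_option linter.unusedSectionVars false
set_option linter.unusedSimpArgs false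

open Cardinal

variable {R Q : Type} [CommRing R] [IsDomain R] [Field Q] [Algebra R Q] [IsFractionRing R Q]

/-- compatibility with the coordinate filtration -/
def Filt (β : (ℕ → R) →+ (ℕ → R)) : Prop :=
  ∀ n v, (∀ i < n, v i = 0) → ∀ i < n, β v i = 0

/-- embedding of `R^ω` in `Q^ω` -/
def jj (R Q : Type) [CommRing R] [Field Q] [Algebra R Q] : (ℕ → R) →+ (ℕ → Q) where
  toFun v := fun i => algebraMap R Q (v i)
  map_zero' := by ext i; simp
  map_add' a b := by ext i; simp

theorem jj_inj : Function.Injective (jj R Q) := by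
  intro a b h
  ext i
  have := congrFun h i
  exact IsFractionRing.injective R Q this

theorem L1 (γ : (ℕ → R) →+ (ℕ → R)) (hγ : Filt γ)
    (hne : ∀ n, ∃ v, (∀ i < n, v i = 0) ∧ γ v ≠ 0) (m : ℕ) :
    ∃ w : (ℕ → Bool) → (ℕ → R), (∀ ε, ∀ i < m, w ε i = 0) ∧
      Function.Injective (fun ε => γ (w ε)) := by
  choose w hw hw' using hne
  choose c hc using fun n => Function.ne_iff.1 (hw' n)
  have hcn : ∀ n, n ≤ c n := by
    intro n
    by_contra h
    exact hc n (hγ n _ (hw n) _ (not_le.1 h))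
  let N : ℕ → ℕ := fun k => Nat.rec m (fun _ n => c n + 1) k
  have hN0 : N 0 = m := rfl
  have hNs : ∀ k, N (k+1) = c (N k) + 1 := fun k => rfl
  have hmono : StrictMono N := strictMono_nat_of_lt_succ (fun k => by
    rw [hNs]; exact Nat.lt_succ_of_le (hcn _))
  have hNm : ∀ k, m ≤ N k := fun k => by
    rw [← hN0]; exact hmono.monotone (Nat.zero_le k)
  have hNk : ∀ k, k ≤ N k := fun k => hmono.id_le k
  let v : (ℕ → Bool) → ℕ → R := fun ε i =>
    ∑ k ∈ Finset.range (i+1), if ε k = true then w (N k) i else 0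
  have key : ∀ ε δ : ℕ → Bool, ∀ k, (∀ l < k, ε l = δ l) → ε k = true → δ k = false →
      γ (v ε) ≠ γ (v δ) := by
    intro ε δ k hl hε hδ he
    have hd : ∀ i < N (k+1), (v ε - v δ - w (N k)) i = 0 := by
      intro i hi
      simp only [Pi.sub_apply, v]
      rw [← Finset.sum_sub_distrib, Finset.sum_eq_single k]
      · simp [hε, hδ]
      · intro l _ hlk
        rcases lt_or_gt_of_ne hlk with h | h
        · rw [hl l h]; simp
        · have : w (N l) i = 0 := hw _ _ (lt_of_lt_of_le hi (hmono.monotone h))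
          simp [this]
      · intro hk
        have : w (N k) i = 0 := hw _ _ (lt_of_lt_of_le (by simpa using hk) (hNk k))
        simp [this]
    have := hγ _ _ hd (c (N k)) (by rw [hNs]; exact Nat.lt_succ_self _)
    rw [map_sub, map_sub, he] at this
    simp at this
    exact hc _ this
  refine ⟨v, ?_, ?_⟩
  · intro ε i hi
    apply Finset.sum_eq_zero
    intro k _
    have : w (N k) i = 0 := hw _ _ (lt_of_lt_of_le hi (hNm k))
    simp [this]
  · intro ε δ he
    by_contra hne
    have hex : ∃ k, ε k ≠ δ k := Function.ne_iff.1 hne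
    classical
    have h1 := Nat.find_spec hex
    have h2 : ∀ l < Nat.find hex, ε l = δ l := fun l hl => by
      have := Nat.find_min hex hl
      simpa using this
    rcases hb : ε (Nat.find hex) with _ | _
    · refine key δ ε _ (fun l hl => (h2 l hl).symm) ?_ hb he.symm
      rw [hb] at h1
      simpa using h1.symm
    · refine key ε δ _ h2 hb ?_ he
      rw [hb] at h1
      simpa using h1.symm

theorem L1' (γ : (ℕ → R) →+ (ℕ → R)) (hγ : Filt γ)
    (hne : ∀ n, ∃ v, (∀ i < n, v i = 0) ∧ γ v ≠ 0) (m : ℕ) (S : Set (ℕ → Q)) (hS : #S < 𝔠) :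
    ∃ v, (∀ i < m, v i = 0) ∧ jj R Q (γ v) ∉ S := by
  obtain ⟨w, hw, hinj⟩ := L1 γ hγ hne m
  by_contra hc
  push Not at hc
  have h1 : #(ℕ → Bool) ≤ #S := by
    refine Cardinal.mk_le_of_injective (f := fun ε => ⟨jj R Q (γ (w ε)), hc _ (hw ε)⟩) ?_
    intro a b h
    apply hinj
    apply jj_inj (R := R) (Q := Q)
    simpa using h
  have h2 : #(ℕ → Bool) = 𝔠 := by simp
  rw [h2] at h1
  exact absurd hS (not_lt.2 h1)

theorem filt_id : Filt (AddMonoidHom.id (ℕ → R)) := fun _ _ h => h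

theorem card_sup_lt [Countable Q] (S : Submodule Q (ℕ → Q)) (hS : #S < 𝔠) (x : ℕ → Q) :
    #(S ⊔ Submodule.span Q {x} : Submodule Q (ℕ → Q)) < 𝔠 := by
  have h : Function.Surjective (fun y : S × Q =>
      (⟨y.1.1 + y.2 • x, Submodule.add_mem_sup y.1.2
        (Submodule.smul_mem _ _ (Submodule.mem_span_singleton_self x))⟩ :
        (S ⊔ Submodule.span Q {x} : Submodule Q (ℕ → Q)))) := by
    rintro ⟨z, hz⟩
    obtain ⟨a, ha, b, hb, rfl⟩ := Submodule.mem_sup.1 hz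
    obtain ⟨c, rfl⟩ := Submodule.mem_span_singleton.1 hb
    exact ⟨(⟨a, ha⟩, c), rfl⟩
  refine (Cardinal.mk_le_of_surjective h).trans_lt ?_
  rw [Cardinal.mk_prod, Cardinal.lift_id, Cardinal.lift_id]
  exact Cardinal.mul_lt_of_lt Cardinal.aleph0_le_continuum hS
    ((Cardinal.mk_le_aleph0 (α := Q)).trans_lt Cardinal.aleph0_lt_continuum)

/-- not eventually a multiplication -/
def BadF (β : (ℕ → R) →+ (ℕ → R)) : Prop :=
  ∀ (f : R) (n : ℕ), ∃ v, (∀ i < n, v i = 0) ∧ β v ≠ f • v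

theorem core [Countable Q] (β : (ℕ → R) →+ (ℕ → R)) (hβ : Filt β) (hbad : BadF β)
    (S : Submodule Q (ℕ → Q)) (hS : #S < 𝔠) (m : ℕ) :
    ∃ v, (∀ i < m, v i = 0) ∧ ∀ a b : Q, a • jj R Q v + b • jj R Q (β v) ∈ S → a = 0 ∧ b = 0 := by
  by_contra hcon
  push Not at hcon
  have hid : ∀ T : Submodule Q (ℕ → Q), #T < 𝔠 → ∃ v : ℕ → R, (∀ i < m, v i = 0) ∧
      jj R Q v ∉ T := fun T hT => by
    refine L1' (Q := Q) (AddMonoidHom.id (ℕ → R)) filt_id ?_ m T hT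
    intro n
    refine ⟨Pi.single n 1, ?_, ?_⟩
    · intro i hi; simp [Pi.single_apply, hi.ne]
    · simp
  have hc : ∀ v : ℕ → R, (∀ i < m, v i = 0) → jj R Q v ∉ S →
      ∃ c : Q, jj R Q (β v) - c • jj R Q v ∈ S := by
    intro v hv hvS
    obtain ⟨a, b, hab, hne⟩ := hcon v hv
    have hb : b ≠ 0 := by
      intro hb
      have ha : a ≠ 0 := fun ha => hne ha hb
      subst hb
      apply hvS
      have := S.smul_mem a⁻¹ hab
      simpa [smul_smul, ha] using this
    refine ⟨-(b⁻¹ * a), ?_⟩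
    have := S.smul_mem b⁻¹ hab
    rw [smul_add, smul_smul, smul_smul, inv_mul_cancel₀ hb, one_smul] at this
    rw [neg_smul, sub_neg_eq_add, add_comm]
    exact this
  have heq : ∀ v w : ℕ → R, (∀ i < m, v i = 0) → (∀ i < m, w i = 0) → jj R Q v ∉ S →
      jj R Q w ∉ S ⊔ Submodule.span Q {jj R Q v} → ∀ c d : Q,
      jj R Q (β v) - c • jj R Q v ∈ S → jj R Q (β w) - d • jj R Q w ∈ S → c = d := by
    intro v w hv hw hvS hwS c d hc1 hd1
    have hvw : jj R Q (v + w) ∉ S := by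
      intro h
      apply hwS
      rw [map_add] at h
      have h1 : jj R Q w = (jj R Q v + jj R Q w) + (-1 : Q) • jj R Q v := by simp
      rw [h1]
      exact Submodule.add_mem_sup h
        (Submodule.smul_mem _ _ (Submodule.mem_span_singleton_self _))
    obtain ⟨e, he⟩ := hc (v + w) (fun i hi => by simp [hv i hi, hw i hi]) hvw
    have h2 : (c - e) • jj R Q v + (d - e) • jj R Q w ∈ S := by
      have := S.sub_mem he (S.add_mem hc1 hd1)
      have h3 : (c - e) • jj R Q v + (d - e) • jj R Q w =
        (jj R Q (β (v+w)) - e • jj R Q (v+w)) -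
          (jj R Q (β v) - c • jj R Q v + (jj R Q (β w) - d • jj R Q w)) := by
        simp only [map_add]; module
      rw [h3]; exact this
    have hde : d = e := by
      by_contra hne
      have hne' : d - e ≠ 0 := sub_ne_zero.2 hne
      apply hwS
      have h3 : jj R Q w = (d - e)⁻¹ • ((c - e) • jj R Q v + (d - e) • jj R Q w) +
          (-((d - e)⁻¹ * (c - e))) • jj R Q v := by
        rw [smul_add, smul_smul, smul_smul, inv_mul_cancel₀ hne']; module
      rw [h3]
      exact Submodule.add_mem_sup (S.smul_mem _ h2)
        (Submodule.smul_mem _ _ (Submodule.mem_span_singleton_self _))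
    subst hde
    by_contra hne
    have hne' : c - d ≠ 0 := sub_ne_zero.2 hne
    apply hvS
    simp at h2
    have := S.smul_mem (c - d)⁻¹ h2
    rwa [smul_smul, inv_mul_cancel₀ hne', one_smul] at this
  obtain ⟨u0, hu0, hu0S⟩ := hid S hS
  obtain ⟨c0, hc0⟩ := hc u0 hu0 hu0S
  have h1 : ∀ v : ℕ → R, (∀ i < m, v i = 0) → jj R Q v ∉ S →
      jj R Q (β v) - c0 • jj R Q v ∈ S := by
    intro v hv hvS
    obtain ⟨c, hcv⟩ := hc v hv hvS
    obtain ⟨u, hu, huS⟩ := hid _ (card_sup_lt _ (card_sup_lt S hS (jj R Q v)) (jj R Q u0))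
    have huS1 : jj R Q u ∉ S := fun h => huS (Submodule.mem_sup_left (Submodule.mem_sup_left h))
    have huS2 : jj R Q u ∉ S ⊔ Submodule.span Q {jj R Q v} := fun h => huS (Submodule.mem_sup_left h)
    have huS3 : jj R Q u ∉ S ⊔ Submodule.span Q {jj R Q u0} := fun h =>
      huS (SetLike.le_def.1 (sup_le_sup_right le_sup_left _) h)
    obtain ⟨d, hd⟩ := hc u hu huS1
    have e1 := heq v u hv hu hvS huS2 c d hcv hd
    have e2 := heq u0 u hu0 hu hu0S huS3 c0 d hc0 hd
    rw [e2, ← e1]; exact hcv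
  have h2 : ∀ v : ℕ → R, (∀ i < m, v i = 0) → jj R Q (β v) - c0 • jj R Q v ∈ S := by
    intro v hv
    by_cases hvS : jj R Q v ∈ S
    · have h3 : jj R Q (v + u0) ∉ S := by
        intro h
        rw [map_add] at h
        exact hu0S ((S.add_mem_iff_right hvS).1 h)
      have h4 := h1 (v + u0) (fun i hi => by simp [hv i hi, hu0 i hi]) h3
      have h5 := S.sub_mem h4 hc0
      have h6 : jj R Q (β v) - c0 • jj R Q v =
        jj R Q (β (v + u0)) - c0 • jj R Q (v + u0) - (jj R Q (β u0) - c0 • jj R Q u0) := by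
        simp only [map_add]; module
      rw [h6]; exact h5
    · exact h1 v hv hvS
  obtain ⟨f, g, hg, hfg⟩ := IsFractionRing.div_surjective (A := R) c0
  have hg0 : g ≠ 0 := nonZeroDivisors.ne_zero hg
  have hgQ : algebraMap R Q g ≠ 0 := by
    intro h
    exact hg0 (IsFractionRing.injective R Q (by simpa using h))
  let γ : (ℕ → R) →+ (ℕ → R) :=
    { toFun := fun v => g • β v - f • v
      map_zero' := by simp
      map_add' := fun a b => by simp only [map_add, smul_add]; abel }
  have hγ : ∀ v, γ v = g • β v - f • v := fun v => rfl
  have hγF : Filt γ := by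
    intro n v hv i hi
    rw [hγ]
    simp [hβ n v hv i hi, hv i hi]
  have hsm : ∀ (r : R) (v : ℕ → R), jj R Q (r • v) = algebraMap R Q r • jj R Q v := by
    intro r v; ext i; simp [jj]
  have hγS : ∀ v, (∀ i < m, v i = 0) → jj R Q (γ v) ∈ S := by
    intro v hv
    have h3 : jj R Q (γ v) = algebraMap R Q g • (jj R Q (β v) - c0 • jj R Q v) := by
      rw [hγ, map_sub, hsm, hsm, smul_sub, smul_smul, ← hfg, mul_div_cancel₀ _ hgQ]
    rw [h3]
    exact S.smul_mem _ (h2 v hv)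
  have h3 : ∃ n, ∀ v, (∀ i < n, v i = 0) → γ v = 0 := by
    by_contra hno
    push Not at hno
    obtain ⟨v, hv, hvS⟩ := L1' (Q := Q) γ hγF hno m S hS
    exact hvS (hγS v hv)
  obtain ⟨n, hn⟩ := h3
  have h4 := hn (Pi.single n 1) (fun i hi => by simp [Pi.single_apply, hi.ne])
  have h5 := congrFun h4 n
  rw [hγ] at h5
  simp at h5
  have h6 : g * β (Pi.single n 1) n = f := by linear_combination h5
  obtain ⟨v, hv, hvne⟩ := hbad (β (Pi.single n 1) n) n
  apply hvne
  have h7 := hn v hv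
  rw [hγ] at h7
  ext i
  have h8 := congrFun h7 i
  simp at h8
  rw [← h6] at h8
  have h9 : g * (β v i - β (Pi.single n 1) n * v i) = 0 := by linear_combination h8
  have h10 := (mul_eq_zero.1 h9).resolve_left hg0
  simp only [Pi.smul_apply, smul_eq_mul]
  linear_combination h10

end Generic

section Generic2

open Cardinal

set_option linter.unusedSectionVars false
set_option linter.unusedSimpArgs false

variable {R Q : Type} [CommRing R] [IsDomain R] [Field Q] [Algebra R Q] [IsFractionRing R Q]

theorem card_span_lt [Countable Q] {J : Type} (v : J → (ℕ → Q)) (hJ : #J < 𝔠) :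
    #(Submodule.span Q (Set.range v)) < 𝔠 := by
  rw [← Finsupp.range_linearCombination]
  have h1 : #(LinearMap.range (Finsupp.linearCombination Q v)) ≤ #(J →₀ Q) :=
    Cardinal.mk_le_of_surjective (LinearMap.surjective_rangeRestrict _)
  refine h1.trans_lt ?_
  have h3 : #Q ≤ ℵ₀ := Cardinal.mk_le_aleph0
  have h2 : #(J →₀ Q) ≤ #(Finset (J × Q)) := by
    refine Cardinal.mk_le_of_injective (f := Finsupp.graph) (Finsupp.graph_injective _ _)
  refine h2.trans_lt ?_
  have h4 : #(J × Q) < 𝔠 := by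
    rw [Cardinal.mk_prod, Cardinal.lift_id, Cardinal.lift_id]
    exact Cardinal.mul_lt_of_lt Cardinal.aleph0_le_continuum hJ
      (h3.trans_lt Cardinal.aleph0_lt_continuum)
  rcases finite_or_infinite (J × Q) with h | h
  · exact (Cardinal.lt_aleph0_of_finite _).trans Cardinal.aleph0_lt_continuum
  · rw [Cardinal.mk_finset_of_infinite]; exact h4

theorem card_filt [Countable R] : #{β : (ℕ → R) →+ (ℕ → R) // Filt β ∧ BadF β} ≤ 𝔠 := by
  have h1 : #{β : (ℕ → R) →+ (ℕ → R) // Filt β ∧ BadF β} ≤ #((ℕ →₀ R) → (ℕ → R)) := by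
    refine Cardinal.mk_le_of_injective (f := fun β w => β.1 (fun i => w i)) ?_
    intro β β' h
    ext v i
    have htr : ∀ γ : (ℕ → R) →+ (ℕ → R), Filt γ →
        γ v i = γ (fun l => (Finsupp.onFinset (Finset.range (i+1))
          (fun l => if l < i + 1 then v l else 0) (by intro a; simp; tauto) : ℕ →₀ R) l) i := by
      intro γ hγ
      have h2 := hγ (i+1) (v - fun l => (Finsupp.onFinset (Finset.range (i+1))
          (fun l => if l < i + 1 then v l else 0) (by intro a; simp; tauto) : ℕ →₀ R) l)
          (by intro l hl; simp [Nat.lt_succ_iff.1 hl]) i (Nat.lt_succ_self i)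
      rw [map_sub, Pi.sub_apply, sub_eq_zero] at h2
      exact h2
    rw [htr _ β.2.1, htr _ β'.2.1]
    exact congrFun (congrFun h _) i
  refine h1.trans ?_
  have h2 : #(ℕ →₀ R) ≤ ℵ₀ := Cardinal.mk_le_aleph0
  have h3 : #(ℕ → R) ≤ 𝔠 := by
    rw [← Cardinal.power_def, Cardinal.mk_nat, ← Cardinal.aleph0_power_aleph0]
    exact Cardinal.power_le_power_right Cardinal.mk_le_aleph0
  rw [← Cardinal.power_def]
  calc #(ℕ → R) ^ #(ℕ →₀ R) ≤ 𝔠 ^ #(ℕ →₀ R) := Cardinal.power_le_power_right h3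
    _ ≤ 𝔠 ^ ℵ₀ := Cardinal.power_le_power_left Cardinal.continuum_ne_zero h2
    _ = 𝔠 := Cardinal.continuum_power_aleph0

/-- kill the odd coordinates -/
def evenHom (R : Type) [CommRing R] : (ℕ → R) →+ (ℕ → R) where
  toFun v i := if Even i then v i else 0
  map_zero' := by ext i; simp
  map_add' a b := by ext i; by_cases h : Even i <;> simp [h]

theorem evenHom_filt : Filt (evenHom R) := by
  intro n v hv i hi
  simp [evenHom, hv i hi]

theorem evenHom_bad : BadF (evenHom R) := by
  intro f n
  by_cases hf : f = 0
  · refine ⟨Pi.single (2 * n) 1, fun i hi => ?_, fun h => ?_⟩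
    · rw [Pi.single_apply, if_neg (by omega)]
    · have := congrFun h (2 * n)
      simp [evenHom, hf] at this
  · refine ⟨Pi.single (2 * n + 1) 1, fun i hi => ?_, fun h => ?_⟩
    · rw [Pi.single_apply, if_neg (by omega)]
    · have := congrFun h (2 * n + 1)
      simp [evenHom] at this
      exact hf this.symm

theorem exists_psi [Countable R] [Countable Q] : ∃ ψ : (ℕ → Q) →ₗ[Q] Q,
    ∀ β : (ℕ → R) →+ (ℕ → R), Filt β → BadF β → ∀ (m : ℕ) (q : Q), ∃ v : ℕ → R,
      (∀ i < m, v i = 0) ∧ ψ (jj R Q v) = 0 ∧ ψ (jj R Q (β v)) = q := by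
  classical
  let I := (Cardinal.ord (𝔠 : Cardinal.{0})).ToType
  let ι := {β : (ℕ → R) →+ (ℕ → R) // Filt β ∧ BadF β} × ℕ × Q
  have hι : #ι ≤ #I := by
    rw [Cardinal.mk_ord_toType]
    simp only [ι, Cardinal.mk_prod, Cardinal.lift_id, Cardinal.mk_nat]
    calc _ ≤ 𝔠 * (ℵ₀ * ℵ₀) := by
          gcongr
          · exact card_filt
          · exact Cardinal.mk_le_aleph0
      _ = 𝔠 := by simp
  haveI : Nonempty ι := ⟨(⟨evenHom R, evenHom_filt, evenHom_bad⟩, 0, 0)⟩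
  obtain ⟨emb⟩ : Nonempty (ι ↪ I) := hι
  let e : I → ι := Function.invFun emb
  have he : Function.Surjective e := Function.invFun_surjective emb.injective
  let S : (i : I) → ((k : I) → k < i → (ℕ → R)) → Submodule Q (ℕ → Q) := fun i g =>
    Submodule.span Q (Set.range (fun z : Set.Iio i × Bool =>
      if z.2 then jj R Q (g z.1.1 z.1.2) else jj R Q ((e z.1.1).1.1 (g z.1.1 z.1.2))))
  have hS : ∀ i g, #(S i g) < 𝔠 := by
    intro i g
    apply card_span_lt
    rw [Cardinal.mk_prod, Cardinal.lift_id, Cardinal.lift_id]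
    refine Cardinal.mul_lt_of_lt Cardinal.aleph0_le_continuum (Cardinal.mk_Iio_toType_ord_lt i) ?_
    exact (Cardinal.lt_aleph0_of_finite _).trans Cardinal.aleph0_lt_continuum
  choose step hstep1 hstep2 using fun (i : I) (g : (k : I) → k < i → (ℕ → R)) =>
    core (e i).1.1 (e i).1.2.1 (e i).1.2.2 (S i g) (hS i g) (e i).2.1
  have wf : WellFounded ((· < ·) : I → I → Prop) := IsWellFounded.wf
  let x : I → (ℕ → R) := wf.fix step
  have hx : ∀ i, x i = step i (fun k _ => x k) := fun i => wf.fix_eq step i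
  have hx1 : ∀ i, ∀ l < (e i).2.1, x i l = 0 := fun i => by rw [hx]; exact hstep1 i _
  have hx2 : ∀ i, ∀ a b : Q, a • jj R Q (x i) + b • jj R Q ((e i).1.1 (x i)) ∈
      S i (fun k _ => x k) → a = 0 ∧ b = 0 := fun i => by
    have := hstep2 i (fun k _ => x k)
    rw [← hx] at this
    exact this
  let L : (I →₀ Q × Q) →ₗ[Q] (ℕ → Q) := Finsupp.lsum Q (fun i =>
    (LinearMap.toSpanSingleton Q _ (jj R Q (x i))).coprod
      (LinearMap.toSpanSingleton Q _ (jj R Q ((e i).1.1 (x i)))))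
  have hLs : ∀ i q, L (Finsupp.single i q) =
      q.1 • jj R Q (x i) + q.2 • jj R Q ((e i).1.1 (x i)) := by
    intro i q
    simp [L]
  have hLs' : ∀ c : I →₀ Q × Q, L c = ∑ i ∈ c.support,
      ((c i).1 • jj R Q (x i) + (c i).2 • jj R Q ((e i).1.1 (x i))) := by
    intro c
    simp [L, Finsupp.sum]
  have hker : LinearMap.ker L = ⊥ := by
    rw [LinearMap.ker_eq_bot']
    intro c hc
    by_contra hne
    have hsupp : c.support.Nonempty := Finsupp.support_nonempty_iff.2 hne
    let i := c.support.max' hsupp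
    have hi : i ∈ c.support := Finset.max'_mem _ _
    rw [hLs', ← Finset.add_sum_erase _ _ hi] at hc
    have h1 : (c i).1 • jj R Q (x i) + (c i).2 • jj R Q ((e i).1.1 (x i)) ∈
        S i (fun k _ => x k) := by
      rw [eq_neg_of_add_eq_zero_left hc]
      apply Submodule.neg_mem
      apply Submodule.sum_mem
      intro k hk
      have hki : k < i := lt_of_le_of_ne (Finset.le_max' _ _ (Finset.mem_of_mem_erase hk))
        (Finset.ne_of_mem_erase hk)
      apply Submodule.add_mem
      · apply Submodule.smul_mem
        apply Submodule.subset_span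
        exact ⟨(⟨k, hki⟩, true), by simp⟩
      · apply Submodule.smul_mem
        apply Submodule.subset_span
        exact ⟨(⟨k, hki⟩, false), by simp⟩
    obtain ⟨h2, h3⟩ := hx2 i _ _ h1
    exact (Finsupp.mem_support_iff.1 hi) (Prod.ext h2 h3)
  obtain ⟨G, hG⟩ := LinearMap.exists_leftInverse_of_injective L hker
  have hG' : ∀ c, G (L c) = c := fun c => LinearMap.congr_fun hG c
  let T : (I →₀ Q × Q) →ₗ[Q] Q := Finsupp.lsum Q (fun i =>
    ((LinearMap.toSpanSingleton Q Q (e i).2.2)).comp (LinearMap.snd Q Q Q))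
  refine ⟨T.comp G, ?_⟩
  intro β hβ hbad m q
  obtain ⟨i, hi⟩ := he (⟨β, hβ, hbad⟩, m, q)
  refine ⟨x i, ?_, ?_, ?_⟩
  · have := hx1 i
    rw [hi] at this
    exact this
  · have h1 : jj R Q (x i) = L (Finsupp.single i (1, 0)) := by rw [hLs]; simp
    rw [LinearMap.comp_apply, h1, hG']
    simp [T]
  · have h1 : jj R Q (β (x i)) = L (Finsupp.single i (0, 1)) := by rw [hLs, hi]; simp
    rw [LinearMap.comp_apply, h1, hG']
    simp [T, hi]

theorem exists_psi' [Countable R] [Countable Q] : ∃ ψ : (ℕ → Q) →ₗ[Q] Q,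
    (∀ (n : ℕ) (q : Q), ∃ v : ℕ → R, (∀ i < n, v i = 0) ∧ ψ (jj R Q v) = q) ∧
    ∀ β : (ℕ → R) →+ (ℕ → R), Filt β → ∀ m,
      (∀ v, (∀ i < m, v i = 0) → ψ (jj R Q v) = 0 → ψ (jj R Q (β v)) = 0) →
      ∃ (f : R) (n : ℕ), ∀ v, (∀ i < n, v i = 0) →
        ψ (jj R Q (β v)) = algebraMap R Q f * ψ (jj R Q v) := by
  obtain ⟨ψ, hψ⟩ := exists_psi (R := R) (Q := Q)
  refine ⟨ψ, ?_, ?_⟩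
  · intro n q
    obtain ⟨v, hv, _, hq⟩ := hψ _ evenHom_filt evenHom_bad n q
    exact ⟨_, evenHom_filt n v hv, hq⟩
  · intro β hβ m hm
    by_cases hbad : BadF β
    · obtain ⟨v, hv, h0, h1⟩ := hψ β hβ hbad m 1
      rw [hm v hv h0] at h1
      exact absurd h1 zero_ne_one
    · unfold BadF at hbad
      push Not at hbad
      obtain ⟨f, n, hn⟩ := hbad
      refine ⟨f, n, fun v hv => ?_⟩
      rw [hn v hv, ← smul_eq_mul, ← map_smul]
      congr 1
      ext i
      simp [jj]

theorem countable_poly (F : Type) [Field F] [Countable F] : Countable (Polynomial F) := by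
  have h : Function.Injective (fun f : Polynomial F => f.toFinsupp.coeff) := by
    intro a b h
    have : a.toFinsupp = b.toFinsupp := by
      exact AddMonoidAlgebra.coeff_injective h
    exact Polynomial.toFinsupp_injective this
  exact h.countable

theorem countable_ratFunc (F : Type) [Field F] [Countable F] : Countable (RatFunc F) := by
  haveI := countable_poly F
  have h : Function.Injective (fun q : RatFunc F => (q.num, q.denom)) := by
    intro a b h
    simp at h
    rw [← RatFunc.num_div_denom a, ← RatFunc.num_div_denom b, h.1, h.2]
  exact h.countable

end Generic2

/-! ### The concrete groups -/

section Concrete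

open Polynomial

set_option linter.unusedSectionVars false
set_option linter.unusedSimpArgs false

/-- the `p`-torsion part -/
def torP (p : ℕ) (G : Type) [AddCommGroup G] : AddSubgroup G where
  carrier := {x | ∃ m : ℕ, p ^ m • x = 0}
  zero_mem' := ⟨0, by simp⟩
  add_mem' := by
    rintro a b ⟨m, hm⟩ ⟨n, hn⟩
    refine ⟨m + n, ?_⟩
    rw [smul_add, pow_add, mul_smul (p ^ m) _ b, hn, mul_comm, mul_smul, hm]
    simp
  neg_mem' := by
    rintro a ⟨m, hm⟩
    exact ⟨m, by rw [smul_neg, hm, neg_zero]⟩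

theorem torP_isP (p : ℕ) (G : Type) [AddCommGroup G] : IsPGroup' p (torP p G) := by
  rintro ⟨x, m, hm⟩
  exact ⟨m, Subtype.ext (by simpa using hm)⟩

/-- a hom from a `p`-group lands in the torsion part -/
def toTor {p : ℕ} {A G : Type} [AddCommGroup A] [AddCommGroup G] (hA : IsPGroup' p A)
    (f : A →+ G) : A →+ torP p G :=
  f.codRestrict (torP p G) (fun a => by
    obtain ⟨n, hn⟩ := hA a
    exact ⟨n, by rw [← map_nsmul, hn, map_zero]⟩)

@[simp] theorem toTor_coe {p : ℕ} {A G : Type} [AddCommGroup A] [AddCommGroup G]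
    (hA : IsPGroup' p A) (f : A →+ G) (a : A) : ((toTor hA f a : torP p G) : G) = f a := rfl

/-- the group `P` -/
abbrev PP (p : ℕ) : Type := torP p ((i : ℕ × ℕ) → ZMod (p ^ i.1))

theorem PP_isP (p : ℕ) : IsPGroup' p (PP p) := torP_isP _ _

/-- coordinate of `P` -/
def PPc (p : ℕ) (i : ℕ × ℕ) : PP p →+ ZMod (p ^ i.1) :=
  (Pi.evalAddMonoidHom _ i).comp (torP p ((i : ℕ × ℕ) → ZMod (p ^ i.1))).subtype

theorem PP_ext {p : ℕ} {a b : PP p} (h : ∀ i, PPc p i a = PPc p i b) : a = b :=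
  Subtype.ext (funext h)

/-- the maps `δ` -/
def del (p : ℕ) (k : ℕ) : PP p →+ PP p :=
  toTor (PP_isP p) (AddMonoidHom.mk' (fun x i => PPc p (i.1, Nat.pair k i.2) x)
    (by intro a b; ext i; simp))

theorem del_comb (p : ℕ) {A : Type} [AddCommGroup A] (hA : IsPGroup' p A)
    (γ : ℕ → (A →+ PP p)) : ∃ γ' : A →+ PP p, ∀ k a, del p k (γ' a) = γ k a := by
  refine ⟨toTor hA (AddMonoidHom.mk' (fun a i => PPc p (i.1, (Nat.unpair i.2).2)
    (γ (Nat.unpair i.2).1 a)) (by intro a b; ext i; simp)), ?_⟩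
  intro k a
  apply Subtype.ext
  ext ⟨n, j⟩
  simp [del, PPc]
  have e : (Nat.unpair (Nat.pair k j)).2 = j := by simp
  have key : ∀ m : ℕ, m = j → ((γ k a).1 (n, m) : ZMod (p ^ n)) = (γ k a).1 (n, j) := by
    rintro m rfl
    rfl
  exact key _ e

theorem PP_sep {p : ℕ} (x : PP p) (h : ∀ n, ∃ y : PP p, x = p ^ n • y) : x = 0 := by
  apply PP_ext
  rintro ⟨n, j⟩
  obtain ⟨y, hy⟩ := h n
  rw [hy, map_nsmul, map_zero, nsmul_eq_mul]
  simp

variable (p : ℕ) [hp : Fact p.Prime]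

/-- multiply coordinate `n` by `p^n` -/
noncomputable def hh : (ℕ → ℤ[X]) →+ (ℕ → ℤ[X]) :=
  AddMonoidHom.mk' (fun u n => p ^ n • u n) (by intro a b; ext1 n; simp)

@[simp] theorem hh_apply (u : ℕ → ℤ[X]) (n : ℕ) : hh p u n = p ^ n • u n := rfl

theorem smul_inj_poly {n : ℕ} {a b : ℤ[X]} (h : p ^ n • a = p ^ n • b) : a = b := by
  have h0 : p ^ n ≠ 0 := pow_ne_zero _ hp.out.ne_zero
  exact smul_right_injective _ h0 h

theorem hh_inj : Function.Injective (hh p) := by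
  intro a b h
  ext1 n
  exact smul_inj_poly p (congrFun h n)

/-- reduction mod `p` -/
noncomputable def red : (ℕ → ℤ[X]) →+ (ℕ → (ZMod p)[X]) :=
  AddMonoidHom.mk' (fun u n => (u n).map (Int.castRingHom (ZMod p)))
    (by intro a b; ext1 n; simp)

@[simp] theorem red_apply (u : ℕ → ℤ[X]) (n : ℕ) :
    red p u n = (u n).map (Int.castRingHom (ZMod p)) := rfl

theorem red_lift (v : ℕ → (ZMod p)[X]) : ∃ u, red p u = v ∧ ∀ i, v i = 0 → u i = 0 := by
  choose g hg using Polynomial.map_surjective (Int.castRingHom (ZMod p)) ZMod.intCast_surjective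
  classical
  refine ⟨fun i => if v i = 0 then 0 else g (v i), ?_, ?_⟩
  · ext1 i
    by_cases h : v i = 0
    · simp [h]
    · simp [h, hg]
  · intro i h
    simp [h]

theorem red_zero {u : ℕ → ℤ[X]} (h : red p u = 0) : ∃ t, u = p • t := by
  have : ∀ i, ∃ t : ℤ[X], u i = p • t := by
    intro i
    have h1 : (u i).map (Int.castRingHom (ZMod p)) = 0 := congrFun h i
    have h2 : (C (p : ℤ)) ∣ u i := by
      rw [Polynomial.C_dvd_iff_dvd_coeff]
      intro j
      have h3 := congrArg (fun f => f.coeff j) h1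
      simp at h3
      exact (ZMod.intCast_zmod_eq_zero_iff_dvd _ _).1 h3
    obtain ⟨t, ht⟩ := h2
    exact ⟨t, by rw [ht]; simp⟩
  choose t ht using this
  exact ⟨t, funext ht⟩

variable (ψ : (ℕ → RatFunc (ZMod p)) →ₗ[RatFunc (ZMod p)] RatFunc (ZMod p))

/-- the functional on integral sequences -/
noncomputable def Psi : (ℕ → ℤ[X]) →+ RatFunc (ZMod p) :=
  ψ.toAddMonoidHom.comp ((jj (ZMod p)[X] (RatFunc (ZMod p))).comp (red p))

theorem Psi_apply (u : ℕ → ℤ[X]) : Psi p ψ u = ψ (jj _ _ (red p u)) := rfl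

/-- the relations -/
noncomputable def NN : AddSubgroup (ℕ → ℤ[X]) := (Psi p ψ).ker.map (hh p)

theorem mem_NN {x} : x ∈ NN p ψ ↔ ∃ u, Psi p ψ u = 0 ∧ hh p u = x := by
  simp [NN, AddSubgroup.mem_map, AddMonoidHom.mem_ker]

theorem hh_mem_NN {u} : hh p u ∈ NN p ψ ↔ Psi p ψ u = 0 := by
  rw [mem_NN]
  constructor
  · rintro ⟨u', h, h'⟩
    rwa [← hh_inj p h']
  · intro h
    exact ⟨u, h, rfl⟩

theorem Psi_p (u : ℕ → ℤ[X]) : Psi p ψ (p • u) = 0 := by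
  rw [map_nsmul, nsmul_eq_mul]
  have : (p : RatFunc (ZMod p)) = 0 := by
    have h := map_natCast (algebraMap (ZMod p) (RatFunc (ZMod p))) p
    rw [← h]; simp
  rw [this, zero_mul]

/-- the group `A1` -/
abbrev A1 : Type := torP p ((ℕ → ℤ[X]) ⧸ NN p ψ)

theorem A1_isP : IsPGroup' p (A1 p ψ) := torP_isP _ _

theorem mem_tor {x : ℕ → ℤ[X]} {m : ℕ} (h : p ^ m • x ∈ NN p ψ) :
    (QuotientAddGroup.mk x : (ℕ → ℤ[X]) ⧸ NN p ψ) ∈ torP p ((ℕ → ℤ[X]) ⧸ NN p ψ) :=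
  ⟨m, by
    rw [← QuotientAddGroup.mk_nsmul]
    exact (QuotientAddGroup.eq_zero_iff _).2 h⟩

theorem mem_tor_of_hh {x w : ℕ → ℤ[X]} {m : ℕ} (h : p ^ m • x = hh p w) :
    (QuotientAddGroup.mk x : (ℕ → ℤ[X]) ⧸ NN p ψ) ∈ torP p ((ℕ → ℤ[X]) ⧸ NN p ψ) := by
  apply mem_tor p ψ (m := m + 1)
  rw [pow_succ', mul_smul, h, ← map_nsmul, hh_mem_NN, Psi_p]

/-- the map onto the elements of infinite height -/
noncomputable def kap : (ℕ → ℤ[X]) →+ A1 p ψ :=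
  (((QuotientAddGroup.mk' (NN p ψ)).comp (hh p)).codRestrict _
    (fun u => mem_tor_of_hh p ψ (m := 0) (w := u) (by simp)))

theorem kap_coe (u : ℕ → ℤ[X]) : ((kap p ψ u : A1 p ψ) : (ℕ → ℤ[X]) ⧸ NN p ψ) =
    QuotientAddGroup.mk (hh p u) := rfl

theorem kap_eq_zero {u} : kap p ψ u = 0 ↔ Psi p ψ u = 0 := by
  rw [← hh_mem_NN, ← Subtype.coe_inj, kap_coe, ← QuotientAddGroup.eq_zero_iff]
  rfl

theorem kap_eq {u u'} : kap p ψ u = kap p ψ u' ↔ Psi p ψ u = Psi p ψ u' := by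
  rw [← sub_eq_zero, ← map_sub, kap_eq_zero, map_sub, sub_eq_zero]

/-- class in `A1` -/
noncomputable def cls (x : ℕ → ℤ[X]) (hx : ∃ m w, p ^ m • x = hh p w) : A1 p ψ :=
  ⟨QuotientAddGroup.mk x, by
    obtain ⟨m, w, h⟩ := hx
    exact mem_tor_of_hh p ψ h⟩

theorem exists_rep (a : A1 p ψ) : ∃ x, ∃ hx : ∃ m w, p ^ m • x = hh p w, a = cls p ψ x hx := by
  obtain ⟨g, m, hm⟩ := a
  obtain ⟨x, rfl⟩ := QuotientAddGroup.mk_surjective g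
  rw [← QuotientAddGroup.mk_nsmul] at hm
  obtain ⟨u, _, hu⟩ := (mem_NN p ψ).1 ((QuotientAddGroup.eq_zero_iff _).1 hm)
  exact ⟨x, ⟨m, u, hu.symm⟩, rfl⟩

theorem cls_eq_kap_iff {x hx} {k : ℕ} {u} : p ^ k • cls p ψ x hx = kap p ψ u ↔
    ∃ w, p ^ k • x = hh p w ∧ Psi p ψ w = Psi p ψ u := by
  have h1 : p ^ k • cls p ψ x hx = kap p ψ u ↔
      (QuotientAddGroup.mk (p ^ k • x) : (ℕ → ℤ[X]) ⧸ NN p ψ) = QuotientAddGroup.mk (hh p u) := by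
    rw [← Subtype.coe_inj]; rfl
  rw [h1, QuotientAddGroup.eq, mem_NN]
  constructor
  · rintro ⟨w, hw, he⟩
    refine ⟨u - w, ?_, by rw [map_sub, hw, sub_zero]⟩
    rw [map_sub, he]; abel
  · rintro ⟨w, hw, he⟩
    exact ⟨u - w, by rw [map_sub, he, sub_self], by rw [map_sub, hw]; abel⟩

/-- the hypothesis (a) on the functional -/
def HypA : Prop := ∀ (n : ℕ) (q : RatFunc (ZMod p)), ∃ v : ℕ → (ZMod p)[X],
  (∀ i < n, v i = 0) ∧ ψ (jj _ _ v) = q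

/-- the hypothesis (b) on the functional -/
def HypB : Prop := ∀ β : (ℕ → (ZMod p)[X]) →+ (ℕ → (ZMod p)[X]), Filt β → ∀ m : ℕ,
  (∀ v, (∀ i < m, v i = 0) → ψ (jj _ _ v) = 0 → ψ (jj _ _ (β v)) = 0) →
  ∃ (f : (ZMod p)[X]) (n : ℕ), ∀ v, (∀ i < n, v i = 0) →
    ψ (jj _ _ (β v)) = algebraMap _ (RatFunc (ZMod p)) f * ψ (jj _ _ v)

theorem exists_hyp : ∃ ψ, HypA p ψ ∧ HypB p ψ := by
  have := countable_poly (ZMod p)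
  have := countable_ratFunc (ZMod p)
  exact exists_psi' (R := (ZMod p)[X]) (Q := RatFunc (ZMod p))

variable {p ψ}

theorem HypA.lift (hA : HypA p ψ) (n : ℕ) (q : RatFunc (ZMod p)) :
    ∃ u : ℕ → ℤ[X], (∀ i < n, u i = 0) ∧ Psi p ψ u = q := by
  obtain ⟨v, hv, hq⟩ := hA n q
  obtain ⟨u, hu, hu0⟩ := red_lift p v
  exact ⟨u, fun i hi => hu0 i (hv i hi), by rw [Psi_apply, hu, hq]⟩

theorem hh_div {u : ℕ → ℤ[X]} {n : ℕ} (hu : ∀ i < n, u i = 0) :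
    ∃ z : ℕ → ℤ[X], (∀ i < n, z i = 0) ∧ (∀ i, z i = p ^ (i - n) • u i) ∧
      p ^ n • z = hh p u := by
  refine ⟨fun i => p ^ (i - n) • u i, fun i hi => by simp [hu i hi], fun i => rfl, ?_⟩
  ext1 i
  rcases lt_or_ge i n with h | h
  · simp [hu i h]
  · simp only [Pi.smul_apply, hh_apply, smul_smul]
    rw [← pow_add, Nat.add_sub_cancel' h]

theorem kap_div (hA : HypA p ψ) (u) (n : ℕ) : ∃ b : A1 p ψ, kap p ψ u = p ^ n • b := by
  obtain ⟨u', hu', he⟩ := hA.lift n (Psi p ψ u)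
  obtain ⟨z, _, _, hz⟩ := hh_div (p := p) hu'
  exact ⟨cls p ψ z ⟨n, u', hz⟩, ((cls_eq_kap_iff p ψ).2 ⟨u', hz, he⟩).symm⟩

theorem hom_kap (hA : HypA p ψ) (f : A1 p ψ →+ PP p) (u) : f (kap p ψ u) = 0 := by
  apply PP_sep
  intro n
  obtain ⟨b, hb⟩ := kap_div hA u n
  exact ⟨f b, by rw [hb, map_nsmul]⟩

variable (p ψ)

/-- coefficient maps -/
noncomputable def fc0 (n j : ℕ) : (ℕ → ℤ[X]) ⧸ NN p ψ →+ ((i : ℕ × ℕ) → ZMod (p ^ i.1)) :=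
  QuotientAddGroup.lift (NN p ψ)
    ((AddMonoidHom.single (fun i : ℕ × ℕ => ZMod (p ^ i.1)) (n, 0)).comp
      (AddMonoidHom.mk' (fun x : ℕ → ℤ[X] => (((x n).coeff j : ℤ) : ZMod (p ^ n)))
        (by intro a b; simp)))
    (by
      intro x hx
      obtain ⟨u, _, rfl⟩ := (mem_NN p ψ).1 hx
      rw [AddMonoidHom.mem_ker, AddMonoidHom.comp_apply]
      have : (AddMonoidHom.mk' (fun x : ℕ → ℤ[X] => (((x n).coeff j : ℤ) : ZMod (p ^ n)))
        (by intro a b; simp)) (hh p u) = 0 := by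
        rw [AddMonoidHom.mk'_apply, hh_apply, Polynomial.coeff_smul, nsmul_eq_mul]
        push_cast
        have h := ZMod.natCast_self (p ^ n)
        push_cast at h
        rw [h, zero_mul]
      rw [this, map_zero])

/-- coefficient maps -/
noncomputable def fc (n j : ℕ) : A1 p ψ →+ PP p :=
  toTor (A1_isP p ψ) ((fc0 p ψ n j).comp (AddSubgroup.subtype _))

theorem fc_cls (n j : ℕ) (x hx) : PPc p (n, 0) (fc p ψ n j (cls p ψ x hx)) =
    (((x n).coeff j : ℤ) : ZMod (p ^ n)) := by
  have : PPc p (n, 0) (fc p ψ n j (cls p ψ x hx)) =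
    (AddMonoidHom.single (fun i : ℕ × ℕ => ZMod (p ^ i.1)) (n, 0))
      (((x n).coeff j : ℤ) : ZMod (p ^ n)) (n, 0) := rfl
  rw [this]
  simp

theorem exists_kap (a : A1 p ψ) (h : ∀ f : A1 p ψ →+ PP p, f a = 0) :
    ∃ u, a = kap p ψ u := by
  obtain ⟨x, hx, rfl⟩ := exists_rep p ψ a
  have : ∀ n, ∃ t : ℤ[X], x n = p ^ n • t := by
    intro n
    have h2 : (C ((p ^ n : ℕ) : ℤ)) ∣ x n := by
      rw [Polynomial.C_dvd_iff_dvd_coeff]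
      intro j
      have h3 := fc_cls p ψ n j x hx
      rw [h, map_zero] at h3
      exact (ZMod.intCast_zmod_eq_zero_iff_dvd _ _).1 h3.symm
    obtain ⟨t, ht⟩ := h2
    exact ⟨t, by rw [ht]; simp⟩
  choose t ht using this
  refine ⟨t, ?_⟩
  have h4 : p ^ 0 • cls p ψ x hx = kap p ψ t :=
    (cls_eq_kap_iff p ψ).2 ⟨t, by simp; exact funext ht, rfl⟩
  simpa using h4

end Concrete

section Concrete2

open Polynomial

set_option linter.unusedSectionVars false
set_option linter.unusedSimpArgs false

variable {p : ℕ} [hp : Fact p.Prime]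
  {ψ : (ℕ → RatFunc (ZMod p)) →ₗ[RatFunc (ZMod p)] RatFunc (ZMod p)}

theorem lemC {A : Type} [AddCommGroup A] (W : AddSubgroup A) (Y : AddSubgroup (PP p))
    (hW : ∀ β : PP p →+ A, ∀ y ∈ Y, β y ∈ W) (y : PP p) (hy : y ∈ Y) (n j : ℕ) (z : A)
    (hz : p ^ n • z = 0) (c : ℤ) (hc : (c : ZMod (p ^ n)) = PPc p (n, j) y) : c • z ∈ W := by
  let f : ZMod (p ^ n) →+ A := ZMod.lift (p ^ n) ⟨zmultiplesHom A z, by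
    rw [zmultiplesHom_apply, natCast_zsmul]; exact hz⟩
  have h := hW (f.comp (PPc p (n, j))) y hy
  rw [AddMonoidHom.comp_apply, ← hc] at h
  have h2 : f (c : ZMod (p ^ n)) = c • z := by
    rw [ZMod.lift_coe]; rfl
  rwa [h2] at h

theorem lemD {A : Type} [AddCommGroup A] (W : AddSubgroup A) (Y : AddSubgroup (PP p))
    (hW : ∀ β : PP p →+ A, ∀ y ∈ Y, β y ∈ W) (y : PP p) (hy : y ∈ Y) (k : ℕ)
    (hk : p ^ k • y ≠ 0) : ∃ N, k + 1 ≤ N ∧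
      ∀ z : A, p ^ N • z = 0 → p ^ (N - (k + 1)) • z ∈ W := by
  have h1 : ∃ i, p ^ k • PPc p i y ≠ 0 := by
    by_contra hno
    push Not at hno
    apply hk
    apply PP_ext
    intro i
    rw [map_nsmul, hno, map_zero]
  obtain ⟨⟨n, j⟩, hnj⟩ := h1
  change p ^ k • (PPc p (n, j) y : ZMod (p ^ n)) ≠ 0 at hnj
  obtain ⟨c, hc⟩ := ZMod.natCast_zmod_surjective (n := p ^ n) (PPc p (n, j) y : ZMod (p ^ n))
  rw [← hc] at hnj
  have hnd : ¬ p ^ n ∣ p ^ k * c := by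
    intro hd
    apply hnj
    rw [nsmul_eq_mul, ← Nat.cast_mul]
    exact (ZMod.natCast_eq_zero_iff _ _).2 hd
  have hc0 : c ≠ 0 := by
    rintro rfl
    simp at hnd
  obtain ⟨r, c', hc', hcr⟩ := Nat.exists_eq_pow_mul_and_not_dvd hc0 p hp.out.ne_one
  have hr : k + r < n := by
    by_contra hle
    apply hnd
    rw [hcr, ← mul_assoc, ← pow_add]
    exact Dvd.dvd.mul_right (pow_dvd_pow _ (not_lt.1 hle)) _
  refine ⟨n, by omega, ?_⟩
  intro z hz
  have h2 : c • z ∈ W := by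
    have := lemC W Y hW y hy n j z hz (c : ℤ) (by rw [← hc]; simp)
    simpa using this
  have hcop : IsCoprime (c' : ℤ) ((p ^ n : ℕ) : ℤ) := by
    rw [Nat.isCoprime_iff_coprime]
    exact Nat.Coprime.pow_right _ ((Nat.Prime.coprime_iff_not_dvd hp.out).2 hc').symm
  obtain ⟨s, t, hst⟩ := hcop
  have h3 : p ^ r • z ∈ W := by
    have h4 : p ^ r • z = s • (c • z) + t • (p ^ r • (p ^ n • z)) := by
      rw [hcr]
      simp only [← natCast_zsmul, smul_smul, ← add_smul]
      congr 1
      push_cast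
      push_cast at hst
      linear_combination -(p : ℤ) ^ r * hst
    rw [h4, hz, smul_zero, smul_zero, add_zero]
    exact W.zsmul_mem h2 s
  have h5 : p ^ (n - (k + 1)) • z = p ^ (n - (k + 1) - r) • (p ^ r • z) := by
    rw [smul_smul, ← pow_add]
    congr 2
    omega
  rw [h5]
  exact W.nsmul_mem h3 _

theorem lemE (hA : HypA p ψ) (N n : ℕ) (hn : n < N) (g : ℤ[X]) :
    ∃ e : ℕ → ℤ[X], (∀ i < N, e i = (Pi.single n g : ℕ → ℤ[X]) i) ∧ p ^ n • e ∈ NN p ψ := by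
  obtain ⟨u, hu, hPu⟩ := hA.lift N (Psi p ψ (Pi.single n g))
  obtain ⟨z, hz0, _, hz⟩ := hh_div (p := p) hu
  refine ⟨Pi.single n g - p ^ (N - n) • z, ?_, ?_⟩
  · intro i hi
    simp [hz0 i hi]
  · have h1 : p ^ n • ((Pi.single n g : ℕ → ℤ[X]) - p ^ (N - n) • z) =
        hh p (Pi.single n g - u) := by
      rw [map_sub, ← hz, smul_sub, smul_smul, ← pow_add, Nat.add_sub_cancel' hn.le]
      congr 1
      ext1 i
      by_cases h : i = n
      · subst h; simp
      · simp [Pi.single_apply, h]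
    rw [h1, hh_mem_NN, map_sub, hPu, sub_self]

theorem A3core (hA : HypA p ψ) (Y : AddSubgroup (PP p)) (k : ℕ) (y0 : PP p) (hy0 : y0 ∈ Y)
    (hk : p ^ k • y0 ≠ 0) (a : A1 p ψ) (ha : p ^ (k + 1) • a = 0)
    (hγ : ∀ γ : A1 p ψ →+ PP p, γ a ∈ Y) (W : AddSubgroup (A1 p ψ))
    (hW : ∀ β : PP p →+ A1 p ψ, ∀ y ∈ Y, β y ∈ W) : a ∈ W := by
  obtain ⟨N, hkN, hN⟩ := lemD W Y hW y0 hy0 k hk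
  obtain ⟨x, hx, rfl⟩ := exists_rep p ψ a
  let W' : AddSubgroup (ℕ → ℤ[X]) :=
    (W.map (AddSubgroup.subtype _)).comap (QuotientAddGroup.mk' (NN p ψ))
  have hW' : ∀ x hx, cls p ψ x hx ∈ W ↔ x ∈ W' := by
    intro x hx
    simp only [W', AddSubgroup.mem_comap, AddSubgroup.mem_map]
    constructor
    · intro h
      exact ⟨_, h, rfl⟩
    · rintro ⟨b, hb, he⟩
      have : b = cls p ψ x hx := Subtype.ext he
      rwa [← this]
  have hcls0 : ∀ (m : ℕ) (x hx), p ^ m • cls p ψ x hx = 0 ↔ p ^ m • x ∈ NN p ψ := by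
    intro m x hx
    have h1 := cls_eq_kap_iff p ψ (x := x) (hx := hx) (k := m) (u := 0)
    rw [map_zero] at h1
    rw [h1, mem_NN]
    simp only [map_zero]
    constructor
    · rintro ⟨w, h, h'⟩; exact ⟨w, h', h.symm⟩
    · rintro ⟨w, h, h'⟩; exact ⟨w, h'.symm, h⟩
  have hex : ∀ (m : ℕ) (x : ℕ → ℤ[X]), p ^ m • x ∈ NN p ψ → ∃ m w, p ^ m • x = hh p w := by
    intro m x h
    obtain ⟨u, _, hu⟩ := (mem_NN p ψ).1 h
    exact ⟨m, u, hu.symm⟩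
  have hxN := (hcls0 _ _ _).1 ha
  obtain ⟨u, hu0, hu⟩ := (mem_NN p ψ).1 hxN
  -- correction terms
  have hterm : ∀ n j : ℕ, ∃ e : ℕ → ℤ[X], n < N →
      (∀ i < N, e i = (Pi.single n (C ((x n).coeff j) * X ^ j) : ℕ → ℤ[X]) i) ∧
      p ^ (k + 1) • e ∈ NN p ψ ∧ e ∈ W' := by
    intro n j
    by_cases hn : n < N
    · obtain ⟨e, he, heN⟩ := lemE hA N n hn (X ^ j)
      refine ⟨((x n).coeff j) • e, fun _ => ⟨?_, ?_, ?_⟩⟩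
      · intro i hi
        rw [Pi.smul_apply, he i hi]
        by_cases h : i = n
        · subst h; simp
        · simp [Pi.single_apply, h]
      · have h1 : (p ^ (k + 1) : ℤ) * (x n).coeff j = p ^ n * (u n).coeff j := by
          have h2 : (p ^ n • u n).coeff j = (p ^ (k + 1) • x n).coeff j :=
            congrArg (fun f => f.coeff j) (congrFun hu n)
          rw [Polynomial.coeff_smul, Polynomial.coeff_smul, nsmul_eq_mul, nsmul_eq_mul] at h2
          push_cast at h2
          exact h2.symm
        have h3 : p ^ (k + 1) • ((x n).coeff j) • e = ((u n).coeff j) • (p ^ n • e) := by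
          simp only [← natCast_zsmul, smul_smul]
          congr 1
          push_cast
          rw [h1, mul_comm]
        rw [h3]
        exact (NN p ψ).zsmul_mem heN _
      · have h4 := lemC W Y hW _ (hγ (fc p ψ n j)) n 0 (cls p ψ e (hex _ _ heN))
          ((hcls0 _ _ _).2 heN) ((x n).coeff j) (fc_cls p ψ n j x hx).symm
        simp only [W', AddSubgroup.mem_comap, AddSubgroup.mem_map]
        exact ⟨_, h4, rfl⟩
    · exact ⟨0, fun h => absurd h hn⟩
  choose e he using hterm
  let s : ℕ → ℤ[X] := ∑ n ∈ Finset.range N, ∑ j ∈ (x n).support, e n j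
  have hsW : s ∈ W' := W'.sum_mem fun n hn => W'.sum_mem fun j _ =>
    (he n j (Finset.mem_range.1 hn)).2.2
  have hsN : p ^ (k + 1) • s ∈ NN p ψ := by
    have h1 : s ∈ (NN p ψ).comap (smulHom (p ^ (k + 1))) :=
      AddSubgroup.sum_mem _ fun n hn => AddSubgroup.sum_mem _ fun j _ =>
        (he n j (Finset.mem_range.1 hn)).2.1
    exact h1
  have hsi : ∀ i < N, s i = x i := by
    intro i hi
    simp only [s, Finset.sum_apply]
    rw [Finset.sum_eq_single i]
    · rw [Finset.sum_congr rfl (fun j _ => (he i j hi).1 i hi)]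
      simp only [Pi.single_eq_same]
      exact (Polynomial.as_sum_support_C_mul_X_pow (x i)).symm
    · intro n hn hni
      apply Finset.sum_eq_zero
      intro j _
      rw [(he n j (Finset.mem_range.1 hn)).1 i hi]
      simp [Pi.single_apply, hni.symm]
    · intro h
      simp at h
      omega
  have hxs : p ^ (k + 1) • (x - s) ∈ NN p ψ := by
    rw [smul_sub]; exact (NN p ψ).sub_mem hxN hsN
  obtain ⟨w, hw0, hw⟩ := (mem_NN p ψ).1 hxs
  have hwi : ∀ i < N, w i = 0 := by
    intro i hi
    have h1 := congrFun hw i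
    simp only [hh_apply, Pi.smul_apply, Pi.sub_apply, hsi i hi, sub_self, smul_zero] at h1
    apply smul_inj_poly p (n := i)
    rw [h1, smul_zero]
  obtain ⟨z, hz0, hzi, hz⟩ := hh_div (p := p) hwi
  have hzN : p ^ N • z ∈ NN p ψ := by rw [hz, hh_mem_NN]; exact hw0
  have hzW : p ^ (N - (k + 1)) • z ∈ W' := by
    have h1 := hN (cls p ψ z (hex _ _ hzN)) ((hcls0 _ _ _).2 hzN)
    simp only [W', AddSubgroup.mem_comap, AddSubgroup.mem_map]
    exact ⟨_, h1, rfl⟩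
  have hxz : x - s = p ^ (N - (k + 1)) • z := by
    have h1 : p ^ (k + 1) • (x - s) = p ^ (k + 1) • (p ^ (N - (k + 1)) • z) := by
      rw [smul_smul, ← pow_add, Nat.add_sub_cancel' hkN, hz, hw]
    ext1 i
    exact smul_inj_poly p (congrFun h1 i)
  rw [hW']
  have : x = (x - s) + s := by abel
  rw [this, hxz]
  exact W'.add_mem hzW hsW

end Concrete2

section Concrete3

open Polynomial

set_option linter.unusedSectionVars false
set_option linter.unusedSimpArgs false

theorem relHom {A B : Type} [AddCommGroup A] [AddCommGroup B] (Γ : AddSubgroup (A × B))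
    (htot : ∀ a, ∃ b, (a, b) ∈ Γ) (hsv : ∀ b, (0, b) ∈ Γ → b = 0) :
    ∃ φ : A →+ B, ∀ a b, (a, b) ∈ Γ ↔ φ a = b := by
  have huni : ∀ a b b', (a, b) ∈ Γ → (a, b') ∈ Γ → b = b' := by
    intro a b b' h h'
    have h1 := Γ.sub_mem h h'
    rw [Prod.mk_sub_mk, sub_self] at h1
    exact sub_eq_zero.1 (hsv _ h1)
  choose f hf using htot
  refine ⟨AddMonoidHom.mk' f ?_, ?_⟩
  · intro a b
    exact huni (a + b) _ _ (hf _) (Γ.add_mem (hf a) (hf b))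
  · intro a b
    constructor
    · intro h; exact huni a _ _ (hf a) h
    · rintro rfl; exact hf a

variable (p : ℕ) [hp : Fact p.Prime]
  (ψ : (ℕ → RatFunc (ZMod p)) →ₗ[RatFunc (ZMod p)] RatFunc (ZMod p))

/-- drop coordinate zero -/
noncomputable def tl : (ℕ → ℤ[X]) →+ (ℕ → ℤ[X]) :=
  AddMonoidHom.mk' (fun u i => if i = 0 then 0 else u i)
    (by intro a b; ext1 i; by_cases h : i = 0 <;> simp [h])

/-- divide by `p` -/
noncomputable def yy : (ℕ → ℤ[X]) →+ (ℕ → ℤ[X]) :=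
  AddMonoidHom.mk' (fun u i => if i = 0 then 0 else p ^ (i - 1) • u i)
    (by intro a b; ext1 i; by_cases h : i = 0 <;> simp [h])

theorem yy_apply (u : ℕ → ℤ[X]) (i : ℕ) : yy p u i = if i = 0 then 0 else p ^ (i - 1) • u i := rfl

theorem p_yy (u : ℕ → ℤ[X]) : p ^ 1 • yy p u = hh p (tl u) := by
  ext1 i
  rw [Pi.smul_apply, hh_apply, yy_apply]
  by_cases h : i = 0
  · simp [tl, h]
  · have h1 : tl u i = u i := by simp [tl, h]
    rw [h1, if_neg h, smul_smul, ← pow_add, Nat.add_sub_cancel' (Nat.one_le_iff_ne_zero.2 h)]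

/-- class of `yy` -/
noncomputable def ycl : (ℕ → ℤ[X]) →+ A1 p ψ :=
  (((QuotientAddGroup.mk' (NN p ψ)).comp (yy p)).codRestrict _
    (fun u => mem_tor_of_hh p ψ (m := 1) (w := tl u) (p_yy p u)))

theorem ycl_eq (u) : ycl p ψ u = cls p ψ (yy p u) ⟨1, _, p_yy p u⟩ := rfl

theorem p_ycl (u) : p • ycl p ψ u = kap p ψ (tl u) := by
  have := (cls_eq_kap_iff p ψ (x := yy p u) (hx := ⟨1, _, p_yy p u⟩) (k := 1)
    (u := tl u)).2 ⟨tl u, p_yy p u, rfl⟩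
  rw [ycl_eq]
  simpa using this

theorem ycl_p (t) : ycl p ψ (p • t) = kap p ψ (tl t) := by
  rw [map_nsmul, p_ycl]

/-- the relation -/
noncomputable def QQ : AddSubgroup (A1 p ψ × (ℕ → (ZMod p)[X])) where
  carrier := {z | ∃ x w, (z.1 : (ℕ → ℤ[X]) ⧸ NN p ψ) = QuotientAddGroup.mk x ∧
    p ^ 1 • x = hh p w ∧ red p w = z.2}
  zero_mem' := ⟨0, 0, rfl, by simp, by simp⟩
  add_mem' := by
    rintro ⟨a, v⟩ ⟨a', v'⟩ ⟨x, w, h1, h2, h3⟩ ⟨x', w', h1', h2', h3'⟩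
    refine ⟨x + x', w + w', ?_, ?_, ?_⟩
    · rw [QuotientAddGroup.mk_add, ← h1, ← h1']; rfl
    · rw [smul_add, h2, h2', map_add]
    · rw [map_add, h3, h3']; rfl
  neg_mem' := by
    rintro ⟨a, v⟩ ⟨x, w, h1, h2, h3⟩
    refine ⟨-x, -w, ?_, ?_, ?_⟩
    · rw [QuotientAddGroup.mk_neg, ← h1]; rfl
    · rw [smul_neg, h2, map_neg]
    · rw [map_neg, h3]; rfl

theorem red_p (t) : red p (p • t) = 0 := by
  ext1 i
  simp

theorem QQ_zero (v) (h : (0, v) ∈ QQ p ψ) : v = 0 := by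
  obtain ⟨x, w, h1, h2, h3⟩ := h
  have h4 : x ∈ NN p ψ := (QuotientAddGroup.eq_zero_iff _).1 h1.symm
  obtain ⟨u, _, rfl⟩ := (mem_NN p ψ).1 h4
  rw [← map_nsmul] at h2
  have h5 := hh_inj p h2
  rw [← h5, pow_one, red_p] at h3
  exact h3.symm

theorem QQ_kap (t) : (kap p ψ t, 0) ∈ QQ p ψ :=
  ⟨hh p t, p • t, rfl, by rw [map_nsmul, pow_one], red_p p t⟩

theorem QQ_exists (a : A1 p ψ) (t) (h : p • a = kap p ψ t) :
    ∃ w, Psi p ψ w = Psi p ψ t ∧ (a, red p w) ∈ QQ p ψ := by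
  obtain ⟨x, hx, rfl⟩ := exists_rep p ψ a
  obtain ⟨w, hw, hP⟩ := (cls_eq_kap_iff p ψ (k := 1)).1 (by simpa using h)
  exact ⟨w, hP, x, w, rfl, hw, rfl⟩

variable {p ψ}

theorem endo_kap (hA : HypA p ψ) (α : A1 p ψ →+ A1 p ψ) (u) :
    ∃ u', α (kap p ψ u) = kap p ψ u' :=
  exists_kap p ψ _ (fun f => hom_kap hA (f.comp α) u)

theorem endo_mul (hA : HypA p ψ) (hB : HypB p ψ) (α : A1 p ψ →+ A1 p ψ) :
    ∃ f : (ZMod p)[X], ∀ u, ∃ u', α (kap p ψ u) = kap p ψ u' ∧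
      Psi p ψ u' = algebraMap _ (RatFunc (ZMod p)) f * Psi p ψ u := by
  let Γ : AddSubgroup ((ℕ → (ZMod p)[X]) × (ℕ → (ZMod p)[X])) :=
    ((QQ p ψ).comap ((α.comp (ycl p ψ)).prodMap (AddMonoidHom.id _))).map
      ((red p).prodMap (AddMonoidHom.id _))
  have hΓ : ∀ v w, (v, w) ∈ Γ ↔ ∃ u, red p u = v ∧ (α (ycl p ψ u), w) ∈ QQ p ψ := by
    intro v w
    simp only [Γ, AddSubgroup.mem_map, AddSubgroup.mem_comap]
    constructor
    · rintro ⟨⟨u, w'⟩, h1, h2⟩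
      simp at h1 h2
      obtain ⟨h2, rfl⟩ := h2
      exact ⟨u, h2, h1⟩
    · rintro ⟨u, h1, h2⟩
      exact ⟨(u, w), h2, by simp [h1]⟩
  have htot : ∀ v, ∃ w, (v, w) ∈ Γ := by
    intro v
    obtain ⟨u, hu, _⟩ := red_lift p v
    obtain ⟨t, ht⟩ := endo_kap hA α (tl u)
    obtain ⟨w, _, hw⟩ := QQ_exists p ψ (α (ycl p ψ u)) t (by rw [← map_nsmul, p_ycl, ht])
    exact ⟨_, (hΓ _ _).2 ⟨u, hu, hw⟩⟩
  have hsv : ∀ w, (0, w) ∈ Γ → w = 0 := by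
    intro w hw
    obtain ⟨u, hu, hw⟩ := (hΓ _ _).1 hw
    obtain ⟨t, rfl⟩ := red_zero p hu
    rw [ycl_p] at hw
    obtain ⟨t', ht'⟩ := endo_kap hA α (tl t)
    rw [ht'] at hw
    have h1 := (QQ p ψ).sub_mem hw (QQ_kap p ψ t')
    rw [Prod.mk_sub_mk, sub_self, sub_zero] at h1
    exact QQ_zero p ψ w h1
  obtain ⟨β, hβ⟩ := relHom Γ htot hsv
  have hfilt : Filt β := by
    intro n v hv i hi
    obtain ⟨u, hu, hu0⟩ := red_lift p v
    have hun : ∀ i < n, u i = 0 := fun i hi => hu0 i (hv i hi)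
    obtain ⟨z, hz0, hzi, hz⟩ := hh_div (p := p) hun
    obtain ⟨z', hz', he⟩ := exists_rep p ψ (α (cls p ψ z ⟨n, u, hz⟩))
    obtain ⟨t, ht⟩ := endo_kap hA α u
    have h1 : p ^ n • cls p ψ z' hz' = kap p ψ t := by
      rw [← he, ← map_nsmul, ← ht]
      congr 1
      exact (cls_eq_kap_iff p ψ).2 ⟨u, hz, rfl⟩
    obtain ⟨w, hw, _⟩ := (cls_eq_kap_iff p ψ).1 h1
    have hy : yy p u = p ^ (n - 1) • z := by
      ext1 l
      rw [yy_apply, Pi.smul_apply, hzi]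
      rcases lt_or_ge l n with hl | hl
      · simp [hun l hl]
      · rw [if_neg (by omega), smul_smul, ← pow_add]
        congr 2
        omega
    have hycl : ycl p ψ u = p ^ (n - 1) • cls p ψ z ⟨n, u, hz⟩ := by
      apply Subtype.ext
      change QuotientAddGroup.mk (yy p u) = QuotientAddGroup.mk (p ^ (n - 1) • z)
      rw [hy]
    have h2 : (v, red p w) ∈ Γ := by
      rw [hΓ]
      refine ⟨u, hu, p ^ (n - 1) • z', w, ?_, ?_, rfl⟩
      · rw [hycl, map_nsmul, he]; rfl
      · rw [smul_smul, ← pow_add, Nat.add_sub_cancel' (by omega), hw]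
    rw [(hβ _ _).1 h2]
    have h3 := congrFun hw i
    rw [Pi.smul_apply, hh_apply] at h3
    have h4 : w i = p ^ (n - i) • z' i := by
      apply smul_inj_poly p (n := i)
      rw [← h3, smul_smul, ← pow_add, Nat.add_sub_cancel' hi.le]
    rw [red_apply, h4]
    have h5 : n - i ≠ 0 := by omega
    simp [h5]
  have hkey : ∀ u : ℕ → ℤ[X], u 0 = 0 → ∃ w, α (kap p ψ u) = kap p ψ w ∧
      Psi p ψ w = ψ (jj _ _ (β (red p u))) := by
    intro u hu
    have htl : tl u = u := by
      ext1 i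
      by_cases h : i = 0
      · subst h; simp [tl, hu]
      · simp [tl, h]
    obtain ⟨t, ht⟩ := endo_kap hA α u
    obtain ⟨w, hPw, hw⟩ := QQ_exists p ψ (α (ycl p ψ u)) t (by rw [← map_nsmul, p_ycl, htl, ht])
    refine ⟨w, by rw [ht, kap_eq, hPw], ?_⟩
    have h2 : (red p u, red p w) ∈ Γ := (hΓ _ _).2 ⟨u, rfl, hw⟩
    rw [(hβ _ _).1 h2, Psi_apply]
  obtain ⟨f, n, hf⟩ := hB β hfilt 1 (by
    intro v hv h0
    obtain ⟨u, hu, hu0⟩ := red_lift p v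
    obtain ⟨w, hw, hP⟩ := hkey u (hu0 0 (hv 0 one_pos))
    rw [hu] at hP
    rw [← hP]
    have h1 : kap p ψ u = 0 := (kap_eq_zero p ψ).2 (by rw [Psi_apply, hu, h0])
    rw [h1, map_zero] at hw
    exact (kap_eq_zero p ψ).1 hw.symm)
  refine ⟨f, fun u => ?_⟩
  obtain ⟨u1, hu1, hPu1⟩ := hA.lift (n + 1) (Psi p ψ u)
  obtain ⟨w, hw, hP⟩ := hkey u1 (hu1 0 (by omega))
  refine ⟨w, ?_, ?_⟩
  · rw [← hw, (kap_eq p ψ).2 hPu1]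
  · rw [hP, hf _ (fun i hi => by simp [hu1 i (by omega)]), ← hPu1, Psi_apply]

end Concrete3

section Final

open Polynomial

set_option linter.unusedSectionVars false
set_option linter.unusedSimpArgs false

theorem isP_prod {p : ℕ} {A B : Type} [AddCommGroup A] [AddCommGroup B] (hA : IsPGroup' p A)
    (hB : IsPGroup' p B) : IsPGroup' p (A × B) := by
  rintro ⟨a, b⟩
  obtain ⟨m, hm⟩ := hA a
  obtain ⟨n, hn⟩ := hB b
  refine ⟨m + n, ?_⟩
  ext
  · simp only [Prod.smul_mk, Prod.fst_zero]
    rw [pow_add, mul_comm, mul_smul, hm, smul_zero]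
  · simp only [Prod.smul_mk, Prod.snd_zero]
    rw [pow_add, mul_smul, hn, smul_zero]

theorem isP_finsupp {p : ℕ} {A : Type} [AddCommGroup A] (hA : IsPGroup' p A) :
    IsPGroup' p (ℕ × ℕ →₀ A) := by
  intro x
  have : x ∈ torP p (ℕ × ℕ →₀ A) := by
    induction x using Finsupp.induction_linear with
    | zero => exact zero_mem _
    | add f g hf hg => exact add_mem hf hg
    | single i a =>
      obtain ⟨n, hn⟩ := hA a
      exact ⟨n, by rw [Finsupp.smul_single, hn, Finsupp.single_zero]⟩
  exact this

variable {p : ℕ} [hp : Fact p.Prime]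
  (ψ : (ℕ → RatFunc (ZMod p)) →ₗ[RatFunc (ZMod p)] RatFunc (ZMod p))

/-- the main group -/
abbrev AA : Type := (ℕ × ℕ →₀ PP p) × ((ℕ × ℕ →₀ PP p) × A1 p ψ)

theorem AA_isP : IsPGroup' p (AA ψ) :=
  isP_prod (isP_finsupp (PP_isP p)) (isP_prod (isP_finsupp (PP_isP p)) (A1_isP p ψ))

/-- inclusion of `A1` -/
noncomputable def io : A1 p ψ →+ AA ψ := (AddMonoidHom.inr _ _).comp (AddMonoidHom.inr _ _)

/-- projection to `A1` -/
noncomputable def pr : AA ψ →+ A1 p ψ := (AddMonoidHom.snd _ _).comp (AddMonoidHom.snd _ _)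

/-- elements of infinite height -/
noncomputable def ik : (ℕ → ℤ[X]) →+ AA ψ := (io ψ).comp (kap p ψ)

variable {ψ}

theorem io_inj : Function.Injective (io ψ) := by
  intro a b h
  exact congrArg (fun z => z.2.2) h

theorem ik_eq {u u'} : ik ψ u = ik ψ u' ↔ Psi p ψ u = Psi p ψ u' := by
  rw [← kap_eq]
  exact io_inj.eq_iff

theorem killed_AA (a : AA ψ) (h : ∀ γ : AA ψ →+ PP p, γ a = 0) : ∃ u, a = ik ψ u := by
  obtain ⟨e, e', a1⟩ := a
  have h1 : e = 0 := by
    ext1 i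
    exact h ((Finsupp.applyAddHom i).comp (AddMonoidHom.fst _ _))
  have h2 : e' = 0 := by
    ext1 i
    exact h ((Finsupp.applyAddHom i).comp ((AddMonoidHom.fst _ _).comp (AddMonoidHom.snd _ _)))
  obtain ⟨u, hu⟩ := exists_kap p ψ a1 (fun f => h (f.comp (pr ψ)))
  refine ⟨u, ?_⟩
  rw [h1, h2, hu]
  rfl

theorem endoA (hA : HypA p ψ) (hB : HypB p ψ) (η : AA ψ →+ AA ψ) :
    ∃ f : (ZMod p)[X], ∀ u, ∃ u', η (ik ψ u) = ik ψ u' ∧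
      Psi p ψ u' = algebraMap _ (RatFunc (ZMod p)) f * Psi p ψ u := by
  obtain ⟨f, hf⟩ := endo_mul hA hB ((pr ψ).comp (η.comp (io ψ)))
  refine ⟨f, fun u => ?_⟩
  obtain ⟨u', h1, h2⟩ := hf u
  refine ⟨u', ?_, h2⟩
  obtain ⟨w, hw⟩ := killed_AA (η (ik ψ u)) (fun γ => hom_kap hA (γ.comp (η.comp (io ψ))) u)
  have h3 : ((pr ψ).comp (η.comp (io ψ))) (kap p ψ u) = kap p ψ w := by
    change pr ψ (η (ik ψ u)) = _
    rw [hw]; rfl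
  rw [h1] at h3
  rw [hw, ik_eq, ← kap_eq, h3]

theorem minChar_AA (hA : HypA p ψ) (hB : HypB p ψ) : MinCharInertia (AA ψ) := by
  refine minChar_of (AddMonoidHom.inl _ _) (AddMonoidHom.fst _ _) (fun e => rfl) (del p)
    (fun γ => del_comb p (AA_isP ψ) γ) (fun γ => del_comb p (PP_isP p) γ) p (AA_isP ψ) ?_ ?_
  · rintro Y - k y hy hky ⟨e, e', a1⟩ ha hγ W hW
    have h1 : AddMonoidHom.inl (ℕ × ℕ →₀ PP p) ((ℕ × ℕ →₀ PP p) × A1 p ψ) e ∈ W := by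
      rw [← Finsupp.sum_single e, Finsupp.sum, map_sum]
      refine W.sum_mem fun i _ => ?_
      exact hW ((AddMonoidHom.inl _ _).comp (Finsupp.singleAddHom i)) _
        (hγ ((Finsupp.applyAddHom i).comp (AddMonoidHom.fst _ _)))
    have h2 : (AddMonoidHom.inr (ℕ × ℕ →₀ PP p) ((ℕ × ℕ →₀ PP p) × A1 p ψ)).comp
        (AddMonoidHom.inl _ _) e' ∈ W := by
      rw [← Finsupp.sum_single e', Finsupp.sum, map_sum]
      refine W.sum_mem fun i _ => ?_
      exact hW (((AddMonoidHom.inr (ℕ × ℕ →₀ PP p) ((ℕ × ℕ →₀ PP p) × A1 p ψ)).comp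
        (AddMonoidHom.inl _ _)).comp (Finsupp.singleAddHom i)) _
        (hγ ((Finsupp.applyAddHom i).comp ((AddMonoidHom.fst _ _).comp (AddMonoidHom.snd _ _))))
    have h3 : io ψ a1 ∈ W := by
      refine A3core hA Y k y hy hky a1 ?_ (fun γ => hγ (γ.comp (pr ψ))) (W.comap (io ψ))
        (fun β y hy => hW ((io ψ).comp β) y hy)
      exact congrArg (fun z => z.2.2) ha
    have h4 := W.add_mem h1 (W.add_mem h2 h3)
    convert h4 using 1
    ext1
    · simp [io]
    · simp [io]
  · intro φ
    obtain ⟨f, hf⟩ := endoA hA hB φ.toAddMonoidHom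
    obtain ⟨g, hg⟩ := endoA hA hB φ.symm.toAddMonoidHom
    have hfg : g * f = 1 := by
      obtain ⟨u, _, hu⟩ := hA.lift 0 1
      obtain ⟨u', h1, h2⟩ := hf u
      obtain ⟨u'', h3, h4⟩ := hg u'
      have h5 : ik ψ u = ik ψ u'' := by
        rw [← h3, ← h1]
        exact (φ.symm_apply_apply _).symm
      rw [ik_eq] at h5
      rw [h4, h2, hu, mul_one, ← map_mul] at h5
      apply IsFractionRing.injective (ZMod p)[X] (RatFunc (ZMod p))
      rw [← h5, map_one]
    have hfu : IsUnit f := IsUnit.of_mul_eq_one g (by rw [mul_comm]; exact hfg)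
    obtain ⟨c, _, hc⟩ := Polynomial.isUnit_iff.1 hfu
    obtain ⟨z, hz⟩ := ZMod.intCast_surjective c
    refine ⟨z, fun a ha => ?_⟩
    obtain ⟨u, rfl⟩ := killed_AA a ha
    obtain ⟨u', h1, h2⟩ := hf u
    change φ (ik ψ u) = _ at h1
    rw [h1, ← map_zsmul, ik_eq, h2, map_zsmul, ← hc, ← hz, zsmul_eq_mul]
    simp

/-! ### The square -/

/-- polynomials in the inverse of the variable -/
noncomputable def Xq (p : ℕ) [Fact p.Prime] : AddSubgroup (RatFunc (ZMod p)) :=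
  (Polynomial.aeval (R := ZMod p) (RatFunc.X (K := ZMod p))⁻¹).toRingHom.toAddMonoidHom.range

theorem mem_Xq {q : RatFunc (ZMod p)} : q ∈ Xq p ↔
    ∃ g : (ZMod p)[X], Polynomial.aeval (RatFunc.X (K := ZMod p))⁻¹ g = q := Iff.rfl

theorem good_X : Good (Xq p) (AddMonoidHom.mulLeft (RatFunc.X (K := ZMod p))) := by
  refine ⟨Set.range (fun c : ZMod p => RatFunc.X * RatFunc.C c), Set.finite_range _, ?_⟩
  rintro _ ⟨q, hq, rfl⟩
  obtain ⟨g, rfl⟩ := mem_Xq.1 hq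
  refine ⟨_, ⟨g.coeff 0, rfl⟩, ?_⟩
  rw [mem_Xq]
  refine ⟨g.divX, ?_⟩
  conv_rhs => rw [← Polynomial.divX_mul_X_add g]
  simp only [AddMonoidHom.coe_mulLeft, map_add, map_mul, aeval_X, aeval_C,
    RatFunc.algebraMap_eq_C]
  have : (RatFunc.X (K := ZMod p)) ≠ 0 := RatFunc.X_ne_zero
  simp only [divX_mul_X_add]
  field_simp
  ring

theorem good_f (f : (ZMod p)[X]) :
    Good (Xq p) (AddMonoidHom.mulLeft (algebraMap _ (RatFunc (ZMod p)) f)) := by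
  induction f using Polynomial.induction_on with
  | C a =>
    refine ⟨{0}, Set.finite_singleton _, ?_⟩
    rintro _ ⟨q, hq, rfl⟩
    obtain ⟨g, rfl⟩ := mem_Xq.1 hq
    refine ⟨0, rfl, ?_⟩
    rw [mem_Xq]
    exact ⟨Polynomial.C a * g, by simp⟩
  | add f g hf hg =>
    have := hf.add hg
    convert this using 1
    ext x
    simp [add_mul]
  | monomial n a h =>
    have := good_X.comp h
    convert this using 1
    ext x
    simp [pow_succ]
    ring

theorem Xq_deg (q : RatFunc (ZMod p)) (hq : q ∈ Xq p) : q.intDegree ≤ 0 := by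
  obtain ⟨g, rfl⟩ := mem_Xq.1 hq
  induction g using Polynomial.induction_on' with
  | add f g hf hg =>
    rw [map_add]
    have hf := hf ⟨f, rfl⟩
    have hg := hg ⟨g, rfl⟩
    by_cases h1 : aeval (RatFunc.X (K := ZMod p))⁻¹ g = 0
    · rw [h1, add_zero]; exact hf
    by_cases h2 : aeval (RatFunc.X (K := ZMod p))⁻¹ f + aeval (RatFunc.X (K := ZMod p))⁻¹ g = 0
    · rw [h2]; simp
    exact (RatFunc.intDegree_add_le h1 h2).trans (max_le hf hg)
  | monomial n a =>
    rw [aeval_monomial]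
    by_cases ha : a = 0
    · simp [ha]
    have h0 : (RatFunc.X (K := ZMod p)) ≠ 0 := RatFunc.X_ne_zero
    have h1 : RatFunc.C a ≠ 0 := by simpa using ha
    have h2 : ∀ n : ℕ, ((RatFunc.X (K := ZMod p))⁻¹ ^ n).intDegree = -n := by
      intro n
      rw [inv_pow, RatFunc.intDegree_inv, ← RatFunc.algebraMap_X, ← map_pow,
        RatFunc.intDegree_polynomial]
      simp
    rw [RatFunc.algebraMap_eq_C, RatFunc.intDegree_mul h1 (pow_ne_zero _ (inv_ne_zero h0)), h2]
    simp

/-- the bad subgroup -/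
noncomputable def XX (ψ : (ℕ → RatFunc (ZMod p)) →ₗ[RatFunc (ZMod p)] RatFunc (ZMod p)) :
    AddSubgroup (AA ψ) := ((Xq p).comap (Psi p ψ)).map (ik ψ)

theorem ik_mem_XX {u} : ik ψ u ∈ XX ψ ↔ Psi p ψ u ∈ Xq p := by
  simp only [XX, AddSubgroup.mem_map, AddSubgroup.mem_comap]
  constructor
  · rintro ⟨w, hw, he⟩
    rw [ik_eq] at he
    rwa [← he]
  · intro h
    exact ⟨u, h, rfl⟩

theorem good_XX (hA : HypA p ψ) (hB : HypB p ψ) (η : AA ψ →+ AA ψ) : Good (XX ψ) η := by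
  obtain ⟨f, hf⟩ := endoA hA hB η
  obtain ⟨F, hF, h⟩ := good_f f
  choose L _ hL using hA.lift 0
  refine ⟨(fun q => ik ψ (L q)) '' F, hF.image _, ?_⟩
  rintro _ ⟨_, ⟨u, hu, rfl⟩, rfl⟩
  obtain ⟨u', h1, h2⟩ := hf u
  obtain ⟨q, hq, hqX⟩ := h _ ⟨Psi p ψ u, hu, rfl⟩
  refine ⟨_, ⟨q, hq, rfl⟩, ?_⟩
  rw [h1]
  change ik ψ u' - ik ψ (L q) ∈ _
  rw [← map_sub, ik_mem_XX, map_sub, hL, h2]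
  exact hqX

theorem good_prod {A : Type} [AddCommGroup A] {X : AddSubgroup A} {η : A →+ A} (h : Good X η)
    (i : A →+ A × A) (hi : ∀ x ∈ X, i x ∈ X.prod X) (r : A × A →+ A)
    (hr : ∀ x ∈ X.prod X, r x ∈ X) : Good (X.prod X) (i.comp (η.comp r)) := by
  obtain ⟨F, hF, h⟩ := h
  refine ⟨i '' F, hF.image _, ?_⟩
  rintro _ ⟨x, hx, rfl⟩
  obtain ⟨f, hf, hfX⟩ := h _ ⟨r x, hr x hx, rfl⟩
  refine ⟨_, ⟨f, hf, rfl⟩, ?_⟩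
  have := hi _ hfX
  rwa [map_sub] at this

theorem charInert_prod {A : Type} [AddCommGroup A] {X : AddSubgroup A}
    (h : ∀ η : A →+ A, Good X η) : CharInertSub (X.prod X) := by
  intro φ
  rw [hatImage_finite_iff]
  let Φ : A × A →+ A × A := φ.toAddMonoidHom
  let i1 := AddMonoidHom.inl A A
  let i2 := AddMonoidHom.inr A A
  let r1 := AddMonoidHom.fst A A
  let r2 := AddMonoidHom.snd A A
  have hi1 : ∀ x ∈ X, i1 x ∈ X.prod X := fun x hx => ⟨hx, X.zero_mem⟩
  have hi2 : ∀ x ∈ X, i2 x ∈ X.prod X := fun x hx => ⟨X.zero_mem, hx⟩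
  have hr1 : ∀ x ∈ X.prod X, r1 x ∈ X := fun x hx => hx.1
  have hr2 : ∀ x ∈ X.prod X, r2 x ∈ X := fun x hx => hx.2
  have h1 := good_prod (h ((r1.comp Φ).comp i1)) i1 hi1 r1 hr1
  have h2 := good_prod (h ((r1.comp Φ).comp i2)) i1 hi1 r2 hr2
  have h3 := good_prod (h ((r2.comp Φ).comp i1)) i2 hi2 r1 hr1
  have h4 := good_prod (h ((r2.comp Φ).comp i2)) i2 hi2 r2 hr2
  have h5 := (h1.add h2).add (h3.add h4)
  have h6 : Φ = i1.comp (((r1.comp Φ).comp i1).comp r1) + i1.comp (((r1.comp Φ).comp i2).comp r2) +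
      (i2.comp (((r2.comp Φ).comp i1).comp r1) + i2.comp (((r2.comp Φ).comp i2).comp r2)) := by
    apply AddMonoidHom.ext
    intro x
    have hx : Φ x = Φ (x.1, 0) + Φ (0, x.2) := by rw [← map_add]; simp
    rw [hx]
    ext1
    · simp [i1, i2, r1, r2]
    · simp [i1, i2, r1, r2]
  have h7 : Good (X.prod X) Φ := by rw [h6]; exact h5
  exact h7

/-- multiplication by the variable -/
noncomputable def mX : (ℕ → ℤ[X]) →+ (ℕ → ℤ[X]) :=
  AddMonoidHom.mk' (fun u i => X * u i) (by intro a b; ext1 i; simp [mul_add])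

theorem Psi_mX (u) : Psi p ψ (mX u) = RatFunc.X * Psi p ψ u := by
  rw [Psi_apply, Psi_apply, ← smul_eq_mul, ← map_smul]
  congr 1
  ext1 i
  simp [jj, mX]

theorem mX_NN : NN p ψ ≤ (NN p ψ).comap mX := by
  intro x hx
  obtain ⟨u, hu, rfl⟩ := (mem_NN p ψ).1 hx
  rw [AddSubgroup.mem_comap]
  have : mX (hh p u) = hh p (mX u) := by
    ext1 i
    simp [mX]
    ring
  rw [this, hh_mem_NN, Psi_mX, hu, mul_zero]

/-- multiplication by the variable on `A1` -/
noncomputable def tX (ψ : (ℕ → RatFunc (ZMod p)) →ₗ[RatFunc (ZMod p)] RatFunc (ZMod p)) :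
    A1 p ψ →+ A1 p ψ :=
  toTor (A1_isP p ψ) ((QuotientAddGroup.map (NN p ψ) (NN p ψ) mX mX_NN).comp
    (AddSubgroup.subtype _))

theorem tX_kap (u) : tX ψ (kap p ψ u) = kap p ψ (mX u) := by
  apply Subtype.ext
  change QuotientAddGroup.mk (mX (hh p u)) = QuotientAddGroup.mk (hh p (mX u))
  congr 1
  ext1 i
  simp [mX]
  ring

theorem not_minChar_sq (hA : HypA p ψ) (hB : HypB p ψ) : ¬ MinCharInertia (AA ψ × AA ψ) := by
  intro hmin
  obtain ⟨Z, hZ, hcom⟩ := hmin _ (charInert_prod (good_XX hA hB))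
  obtain ⟨hXZ, hZX⟩ := Commens_iff.1 hcom
  have hinv : ∀ (η : AA ψ →+ AA ψ) (a : AA ψ), (a, 0) ∈ Z → (η a, 0) ∈ Z := by
    intro η a ha
    let e : AA ψ × AA ψ ≃+ AA ψ × AA ψ :=
      { toFun := fun z => (z.1, z.2 + η z.1)
        invFun := fun z => (z.1, z.2 - η z.1)
        left_inv := fun z => by simp
        right_inv := fun z => by simp
        map_add' := fun x y => by
          ext1
          · rfl
          · simp only [Prod.fst_add, Prod.snd_add, map_add]; abel }
    have h1 : (a, η a) ∈ Z := by
      have := hZ e ⟨(a, 0), ha, rfl⟩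
      simpa [e] using this
    have h2 : (0, η a) ∈ Z := by
      have := Z.sub_mem h1 ha
      simpa using this
    exact hZ AddEquiv.prodComm ⟨(0, η a), h2, rfl⟩
  choose L _ hL using hA.lift 0
  have hT0 : (RatFunc.X (K := ZMod p)) ≠ 0 := RatFunc.X_ne_zero
  -- a nonzero element
  obtain ⟨l, k, hlk, hq⟩ := hXZ.pigeon (fun n => (ik ψ (L ((RatFunc.X (K := ZMod p))⁻¹ ^ n)), 0))
    (fun n => ⟨ik_mem_XX.2 (by rw [hL, mem_Xq]; exact ⟨X ^ n, by simp⟩), zero_mem _⟩)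
  rw [Prod.mk_sub_mk, sub_zero, ← map_sub] at hq
  obtain ⟨u, hu⟩ : ∃ u, u = L ((RatFunc.X (K := ZMod p))⁻¹ ^ k) - L (RatFunc.X⁻¹ ^ l) := ⟨_, rfl⟩
  rw [← hu] at hq
  have hdiff : ∀ i j : ℕ, j < i → ((RatFunc.X (K := ZMod p)) ^ i - RatFunc.X ^ j) ≠ 0 ∧
      ((RatFunc.X (K := ZMod p)) ^ i - RatFunc.X ^ j).intDegree = (i : ℤ) := by
    intro i j hij
    have h1 : (RatFunc.X (K := ZMod p)) ^ i - RatFunc.X ^ j =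
        algebraMap (ZMod p)[X] (RatFunc (ZMod p)) (X ^ i - X ^ j) := by simp
    have h2 : ((X : (ZMod p)[X]) ^ i - X ^ j).natDegree = i := by
      rw [Polynomial.natDegree_sub_eq_left_of_natDegree_lt] <;> simp [hij]
    rw [h1]
    constructor
    · intro h3
      have h4 : (X : (ZMod p)[X]) ^ i - X ^ j = 0 := by
        apply IsFractionRing.injective (ZMod p)[X] (RatFunc (ZMod p))
        rw [h3, map_zero]
      rw [h4] at h2
      simp at h2
      omega
    · rw [RatFunc.intDegree_polynomial, h2]
  obtain ⟨q, hqdef⟩ : ∃ q, q = Psi p ψ u := ⟨_, rfl⟩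
  have hq0 : q ≠ 0 := by
    rw [hqdef, hu, map_sub, hL, hL]
    intro h
    have h1 : (RatFunc.X (K := ZMod p)) ^ (k + l) *
        ((RatFunc.X (K := ZMod p))⁻¹ ^ k - RatFunc.X⁻¹ ^ l) = -(RatFunc.X ^ k - RatFunc.X ^ l) := by
      have hX0 : (RatFunc.X (K := ZMod p)) ≠ 0 := RatFunc.X_ne_zero
      have hi : ∀ n : ℕ, (RatFunc.X (K := ZMod p)) ^ n * (RatFunc.X (K := ZMod p))⁻¹ ^ n = 1 := by
        intro n
        rw [← mul_pow, mul_inv_cancel₀ hX0, one_pow]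
      rw [pow_add]
      linear_combination (RatFunc.X (K := ZMod p)) ^ l * hi k - (RatFunc.X (K := ZMod p)) ^ k * hi l
    rw [h, mul_zero] at h1
    exact (hdiff k l hlk).1 (neg_eq_zero.1 h1.symm)
  -- multiply by powers
  have hpow : ∀ n : ℕ, (ik ψ (mX^[n] u), (0 : AA ψ)) ∈ Z ∧
      Psi p ψ (mX^[n] u) = RatFunc.X ^ n * q := by
    intro n
    induction n with
    | zero => exact ⟨hq, by simp [hqdef]⟩
    | succ n ih =>
      rw [Function.iterate_succ_apply', Psi_mX, ih.2]
      refine ⟨?_, by rw [pow_succ]; ring⟩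
      have h1 := hinv ((io ψ).comp ((tX ψ).comp (pr ψ))) _ ih.1
      have h2 : ((io ψ).comp ((tX ψ).comp (pr ψ))) (ik ψ (mX^[n] u)) =
          ik ψ (mX (mX^[n] u)) := by
        change io ψ (tX ψ (kap p ψ _)) = io ψ (kap p ψ _)
        rw [tX_kap]
      rwa [h2] at h1
  obtain ⟨l, k, hlk, hd⟩ := hZX.pigeon
    (fun n => (ik ψ (mX^[n + (q.intDegree.natAbs + 1)] u), 0)) (fun n => (hpow _).1)
  rw [Prod.mk_sub_mk, ← map_sub] at hd
  have h1 := ik_mem_XX.1 hd.1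
  rw [map_sub, (hpow _).2, (hpow _).2, ← sub_mul] at h1
  have h2 := Xq_deg _ h1
  obtain ⟨h3, h4⟩ := hdiff (k + (q.intDegree.natAbs + 1)) (l + (q.intDegree.natAbs + 1)) (by omega)
  rw [RatFunc.intDegree_mul h3 hq0, h4] at h2
  have h5 := neg_abs_le q.intDegree
  push_cast at h2
  have h6 : (0 : ℤ) ≤ (k : ℤ) := Int.natCast_nonneg k
  linarith

end Final


/-- Corollary 3.3: for every prime `p` there is a `p`-group `A` with minimal characteristic
inertia whose square `A ⊕ A` does not have minimal characteristic inertia. -/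
theorem stmt_18 (p : ℕ) (hp : p.Prime) :
    ∃ (A : Type) (_ : AddCommGroup A), IsPGroup' p A ∧
      MinCharInertia A ∧ ¬ MinCharInertia (A × A) := by
  haveI : Fact p.Prime := ⟨hp⟩
  obtain ⟨ψ, hA, hB⟩ := exists_hyp p
  exact ⟨AA ψ, inferInstance, AA_isP ψ, minChar_AA hA hB, not_minChar_sq hA hB⟩
end

section
/- There exists an abelian 2-group G possessing a subgroup X that is characteristic in G and fully inert in G, but is not commensurable with any fully invariant subgroup of G. -/
namespace Ex
open Polynomial Cardinal Set

abbrev N : Type := ℕ → ℤ[X]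

section generic
variable {L : Type} [Field L] (ρ : ℤ[X] →+* L)

/-- coordinatewise reduction -/
noncomputable def red : N →+ (ℕ → L) where
  toFun x n := ρ (x n)
  map_zero' := by ext n; simp
  map_add' x y := by ext n; simp

@[simp] lemma red_apply (x : N) (n : ℕ) : red ρ x n = ρ (x n) := rfl

def Filt (T : N →+ (ℕ → L)) : Prop :=
  ∀ m (x : N), (∀ n < m, x n = 0) → ∀ n < m, T x n = 0

def Bad (T : N →+ (ℕ → L)) : Prop :=
  ∃ D : (ℕ → Bool) → N, ∀ ε ε', ε ≠ ε' →
    ∃ p q, T (D ε - D ε') p * red ρ (D ε - D ε') q ≠ T (D ε - D ε') q * red ρ (D ε - D ε') p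

lemma good_of_not_bad (T : N →+ (ℕ → L)) (hT : Filt T) (hb : ¬ Bad ρ T) :
    ∃ m, ∀ x : N, (∀ n < m, x n = 0) → T x = (T (Pi.single m 1) m) • red ρ x := by
  have key : ∃ m, ∀ x : N, (∀ n < m, x n = 0) → ∀ p q, T x p * red ρ x q = T x q * red ρ x p := by
    by_contra hcon
    push Not at hcon
    apply hb
    choose w hw p q hpq using hcon
    let M : ℕ → ℕ := fun m => m + p m + q m + 1
    let ms : ℕ → ℕ := fun i => M^[i] 0
    have hms : ∀ i, ms (i+1) = M (ms i) := fun i => Function.iterate_succ_apply' M i 0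
    have hmono : StrictMono ms := strictMono_nat_of_lt_succ (fun i => by
      rw [hms]; simp only [M]; omega)
    refine ⟨fun ε n => ∑ i ∈ Finset.range (n+1), if ε i then w (ms i) n else 0, ?_⟩
    intro ε ε' hne
    have hex : ∃ i, ε i ≠ ε' i := by
      by_contra h; push Not at h; exact hne (funext h)
    classical
    set i0 := Nat.find hex with hi0
    have hi0s : ε i0 ≠ ε' i0 := Nat.find_spec hex
    have hlt : ∀ i < i0, ε i = ε' i := fun i hi => by
      have := Nat.find_min hex hi; simpa using this
    set d : N := (fun n => ∑ i ∈ Finset.range (n+1), if ε i then w (ms i) n else 0) -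
      (fun n => ∑ i ∈ Finset.range (n+1), if ε' i then w (ms i) n else 0) with hd
    have hdn : ∃ c : ℤ, c * c = 1 ∧ ∀ n < ms (i0+1), d n = c • w (ms i0) n := by
      refine ⟨if ε i0 then 1 else -1, by split_ifs <;> simp, ?_⟩
      intro n hn
      rw [hd]
      simp only [Pi.sub_apply]
      rw [← Finset.sum_sub_distrib]
      by_cases hle : i0 ≤ n
      · rw [Finset.sum_eq_single i0]
        · cases h1 : ε i0 <;> cases h2 : ε' i0 <;> simp_all
        · intro i _ hi
          rcases lt_or_gt_of_ne hi with h | h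
          · rw [hlt i h]; simp
          · have : w (ms i) n = 0 := hw _ _ (lt_of_lt_of_le hn (hmono.monotone h))
            simp [this]
        · intro h; simp at h; omega
      · have h0 : w (ms i0) n = 0 := hw _ _ (lt_of_lt_of_le (by omega) (hmono.le_apply))
        rw [h0, smul_zero]
        apply Finset.sum_eq_zero
        intro i hi
        rw [Finset.mem_range] at hi
        rw [hlt i (by omega)]; simp
    obtain ⟨c, hc, hdc⟩ := hdn
    have hcL : (c : L) * c = 1 := by exact_mod_cast congrArg (Int.cast : ℤ → L) hc
    have hTd : ∀ n < ms (i0+1), T d n = c * T (w (ms i0)) n := by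
      intro n hn
      have := hT (ms (i0+1)) (d - c • w (ms i0)) (fun k hk => by
        simp [hdc k hk]) n hn
      rw [map_sub, map_zsmul] at this
      rw [Pi.sub_apply, Pi.smul_apply, zsmul_eq_mul] at this
      linear_combination this
    have hrd : ∀ n < ms (i0+1), red ρ d n = c * red ρ (w (ms i0)) n := by
      intro n hn
      simp [hdc n hn]
    have hp : p (ms i0) < ms (i0+1) := by rw [hms]; simp only [M]; omega
    have hq : q (ms i0) < ms (i0+1) := by rw [hms]; simp only [M]; omega
    refine ⟨p (ms i0), q (ms i0), ?_⟩
    rw [hTd _ hp, hTd _ hq, hrd _ hp, hrd _ hq]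
    intro h
    apply hpq (ms i0)
    linear_combination h - (T (w (ms i0)) (p (ms i0)) * red ρ (w (ms i0)) (q (ms i0)) -
      T (w (ms i0)) (q (ms i0)) * red ρ (w (ms i0)) (p (ms i0))) * hcL
  obtain ⟨m, hm⟩ := key
  refine ⟨m, ?_⟩
  have pol : ∀ x y : N, (∀ n < m, x n = 0) → (∀ n < m, y n = 0) → ∀ p q,
      T x p * red ρ y q + T y p * red ρ x q = T x q * red ρ y p + T y q * red ρ x p := by
    intro x y hx hy p q
    have h1 := hm x hx p q
    have h2 := hm y hy p q
    have h3 := hm (x + y) (fun n hn => by simp [hx n hn, hy n hn]) p q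
    simp only [map_add, Pi.add_apply] at h3
    linear_combination h3 - h1 - h2
  have main : ∀ k, m ≤ k → ∀ x : N, (∀ n < m, x n = 0) → ∀ p, p ≠ k →
      T x p = T (Pi.single k 1) k * red ρ x p := by
    intro k hk x hx p hp
    have he : ∀ n < m, (Pi.single k 1 : N) n = 0 := fun n hn => by
      rw [Pi.single_eq_of_ne (by omega)]
    have h1 := pol x _ hx he p k
    have h2 := hm _ he p k
    simp only [red_apply, Pi.single_eq_same, Pi.single_eq_of_ne hp, map_one, map_zero, mul_zero,
      mul_one, zero_add] at h1 h2
    rw [h2] at h1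
    simpa using h1
  intro x hx
  have he : ∀ n < m, (Pi.single (m+1) 1 : N) n = 0 := fun n hn => by
      rw [Pi.single_eq_of_ne (by omega)]
  have hg := main m le_rfl _ he (m+1) (by omega)
  simp only [red_apply, Pi.single_eq_same, map_one, mul_one] at hg
  ext p
  rw [Pi.smul_apply, smul_eq_mul]
  by_cases hp : p = m
  · rw [← hg]
    exact main (m+1) (by omega) x hx p (by omega)
  · exact main m le_rfl x hx p hp

end generic

section lin
variable {L V : Type} [Field L] [AddCommGroup V] [Module L V]

lemma exchange {I : Type} [LinearOrder I] (E : Set V) (u : I → V) (Z : Set I) (x : V)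
    (hx : x ∈ Submodule.span L (E ∪ u '' Z)) :
    x ∈ Submodule.span L E ∨ ∃ ξ ∈ Z, u ξ ∈ Submodule.span L (insert x (E ∪ u '' Iio ξ)) := by
  classical
  have hF : ∃ F : Finset I, ↑F ⊆ Z ∧ x ∈ Submodule.span L (E ∪ u '' F) := by
    rw [Submodule.span_union, Submodule.mem_sup] at hx
    obtain ⟨e, he, y, hy, rfl⟩ := hx
    obtain ⟨t, ht, c, hc⟩ := Submodule.mem_span_image_iff_exists_fun L |>.1 hy
    refine ⟨t, ht, add_mem (Submodule.span_mono subset_union_left he) ?_⟩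
    rw [← hc]
    refine Submodule.sum_mem _ fun i _ => Submodule.smul_mem _ _ (Submodule.subset_span ?_)
    exact Or.inr ⟨i, i.2, rfl⟩
  obtain ⟨F, hFZ, hxF⟩ := hF
  induction F using Finset.induction_on_max with
  | empty => left; simpa using hxF
  | insert a s hs ih =>
    have : E ∪ u '' ↑(insert a s) = insert (u a) (E ∪ u '' ↑s) := by
      rw [Finset.coe_insert, image_insert_eq, union_insert]
    rw [this, Submodule.mem_span_insert] at hxF
    obtain ⟨c, z, hz, hxz⟩ := hxF
    by_cases hc : c = 0
    · apply ih (fun i hi => hFZ (by simp at hi ⊢; tauto))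
      rw [hxz, hc]; simpa using hz
    · right
      refine ⟨a, hFZ (by simp), ?_⟩
      have : u a = c⁻¹ • (x - z) := by
        rw [hxz, add_sub_cancel_right, smul_smul, inv_mul_cancel₀ hc, one_smul]
      rw [this]
      refine Submodule.smul_mem _ _ (sub_mem (Submodule.subset_span (mem_insert _ _)) ?_)
      refine Submodule.span_mono ?_ hz
      refine Subset.trans ?_ (subset_insert _ _)
      refine union_subset_union_right _ (image_mono ?_)
      intro i hi; exact hs i hi

lemma span_card [Countable L] [Infinite L] (S : Set V) (hS : #S < 𝔠) :
    #(Submodule.span L S) < 𝔠 := by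
  have h1 : #(Submodule.span L S) ≤ #(S →₀ L) := by
    have : Submodule.span L S = LinearMap.range (Finsupp.linearCombination L ((↑) : S → V)) := by
      rw [Finsupp.range_linearCombination, Subtype.range_coe]
    rw [this]
    exact mk_le_of_surjective (LinearMap.surjective_rangeRestrict _)
  refine h1.trans_lt ?_
  rcases isEmpty_or_nonempty S with h | h
  · exact (mk_le_aleph0).trans_lt aleph0_lt_continuum
  · rw [mk_finsupp_of_infinite']
    exact max_lt hS (mk_le_aleph0.trans_lt aleph0_lt_continuum)

lemma recursion {I M : Type} [LinearOrder I] [WellFoundedLT I] (Good : (ξ : I) → (Iio ξ → M) → M → Prop)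
    (h : ∀ ξ f, ∃ v, Good ξ f v) : ∃ v : I → M, ∀ ξ, Good ξ (fun η => v η) (v ξ) := by
  choose c hc using h
  refine ⟨wellFounded_lt.fix (fun ξ ih => c ξ (fun η => ih η.1 η.2)), fun ξ => ?_⟩
  rw [WellFounded.fix_eq]
  exact hc _ _
end lin

section generic2
variable {L : Type} [Field L] (ρ : ℤ[X] →+* L)

lemma filt_trunc (T : N →+ (ℕ → L)) (hT : Filt T) (x : N) (n : ℕ) :
    T x n = T (fun k => ((List.range (n+1)).map x).getD k 0) n := by
  have := hT (n+1) (x - fun k => ((List.range (n+1)).map x).getD k 0) (fun k hk => by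
    simp [List.getD, hk]) n (by omega)
  rw [map_sub, Pi.sub_apply, sub_eq_zero] at this
  exact this

lemma card_bad [Countable L] : #{T : N →+ (ℕ → L) // Filt T ∧ Bad ρ T} ≤ 𝔠 := by
  have h1 : #{T : N →+ (ℕ → L) // Filt T ∧ Bad ρ T} ≤ #(ℕ × List ℤ[X] → L) := by
    refine mk_le_of_injective (f := fun T a => T.1 (fun k => a.2.getD k 0) a.1) ?_
    intro T S h
    apply Subtype.ext
    ext x n
    rw [filt_trunc T.1 T.2.1, filt_trunc S.1 S.2.1]
    exact congrFun h (n, (List.range (n+1)).map x)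
  refine h1.trans ?_
  rw [← power_def]
  have : Countable ℤ[X] := by
    rw [← mk_le_aleph0_iff]
    exact Polynomial.cardinalMk_le_max.trans (by simp)
  calc #L ^ #(ℕ × List ℤ[X]) ≤ 𝔠 ^ #(ℕ × List ℤ[X]) :=
        power_le_power_right (mk_le_aleph0.trans aleph0_le_continuum)
    _ ≤ 𝔠 ^ ℵ₀ := power_le_power_left continuum_ne_zero mk_le_aleph0
    _ = 𝔠 := continuum_power_aleph0

lemma exists_K [Countable L] [Infinite L] (θ : ℕ → L) (hθ : ∀ n, θ n ≠ 0) :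
    ∃ K : Submodule L (ℕ → L), (∀ v : ℕ → L, (∃ m, ∀ n, m ≤ n → v n = 0) → v ∈ K) ∧ θ ∉ K ∧
      ∀ T : N →+ (ℕ → L), Filt T → (∀ x, red ρ x ∈ K → T x ∈ K) →
        ∃ m, ∀ x : N, (∀ n < m, x n = 0) → T x = (T (Pi.single m 1) m) • red ρ x := by
  classical
  let I := {T : N →+ (ℕ → L) // Filt T ∧ Bad ρ T}
  obtain ⟨_, _, hI⟩ := exists_ord_eq_type_lt I
  let E : Set (ℕ → L) := range (fun n => Pi.single n 1)
  let S : (ξ : I) → (Iio ξ → N) → Set (ℕ → L) := fun ξ f =>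
    (insert θ E ∪ range (fun η => red ρ (f η))) ∪ range (fun η : Iio ξ => η.1.1 (f η))
  have hS : ∀ ξ f, #(Submodule.span L (S ξ f)) < 𝔠 := by
    intro ξ f
    apply span_card
    have hc : ∀ g : Iio ξ → (ℕ → L), #(range g) < 𝔠 := fun g =>
      mk_range_le.trans_lt ((mk_Iio_lt ξ hI).trans_le (card_bad ρ))
    refine (mk_union_le _ _).trans_lt (add_lt_of_lt aleph0_le_continuum ?_ (hc _))
    refine (mk_union_le _ _).trans_lt (add_lt_of_lt aleph0_le_continuum ?_ (hc _))
    have : (insert θ E).Countable := (countable_range _).insert _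
    exact (le_aleph0_iff_set_countable.2 this).trans_lt aleph0_lt_continuum
  obtain ⟨v, hv⟩ := recursion (I := I) (M := N) (fun ξ f v => red ρ v ∉ Submodule.span L (S ξ f) ∧
    ∀ g : L, ξ.1 v - g • red ρ v ∉ Submodule.span L (S ξ f)) (by
    intro ξ f
    by_contra hcon
    push Not at hcon
    obtain ⟨D, hD⟩ := ξ.2.2
    let W := Submodule.span L (S ξ f)
    have h1 : ∀ ε, ∃ a : W ⊕ (L × W), (∀ w, a = Sum.inl w → red ρ (D ε) = w) ∧
        (∀ w, a = Sum.inr w → ξ.1 (D ε) - w.1 • red ρ (D ε) = w.2) := by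
      intro ε
      by_cases h : red ρ (D ε) ∈ W
      · exact ⟨Sum.inl ⟨_, h⟩, by rintro w ⟨⟩; rfl, by rintro w ⟨⟩⟩
      · obtain ⟨g, hg⟩ := hcon (D ε) h
        exact ⟨Sum.inr ⟨g, ⟨_, hg⟩⟩, by rintro w ⟨⟩, by rintro w ⟨⟩; rfl⟩
    choose a ha1 ha2 using h1
    have hni : ¬ Function.Injective a := by
      intro hinj
      have := mk_le_of_injective hinj
      rw [← power_def, mk_bool, mk_nat, two_power_aleph0] at this
      refine absurd this (not_le.2 ?_)
      rw [mk_sum, mk_prod]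
      simp only [lift_id]
      exact add_lt_of_lt aleph0_le_continuum (hS ξ f) (mul_lt_of_lt aleph0_le_continuum
        (mk_le_aleph0.trans_lt aleph0_lt_continuum) (hS ξ f))
    rw [Function.not_injective_iff] at hni
    obtain ⟨ε, ε', he, hne⟩ := hni
    obtain ⟨p, q, hpq⟩ := hD ε ε' hne
    apply hpq
    rcases hw : a ε with w | w
    · have : red ρ (D ε - D ε') = 0 := by
        rw [map_sub, ha1 ε w hw, ha1 ε' w (he ▸ hw), sub_self]
      rw [this]; simp
    · have : ξ.1 (D ε - D ε') = w.1 • red ρ (D ε - D ε') := by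
        have e1 := ha2 ε w hw
        have e2 := ha2 ε' w (he ▸ hw)
        rw [map_sub, map_sub, smul_sub, sub_eq_sub_iff_sub_eq_sub, e1, e2]
      rw [this]; simp only [Pi.smul_apply, smul_eq_mul]; ring)
  let u : I → (ℕ → L) := fun ξ => red ρ (v ξ)
  have hE : ∀ w : ℕ → L, (∃ m, ∀ n, m ≤ n → w n = 0) → w ∈ Submodule.span L E := by
    rintro w ⟨m, hm⟩
    have : w = ∑ i ∈ Finset.range m, w i • (Pi.single i 1 : ℕ → L) := by
      ext n
      simp only [Finset.sum_apply, Pi.smul_apply, Pi.single_apply, smul_eq_mul, mul_ite, mul_one,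
        mul_zero, Finset.sum_ite_eq, Finset.mem_range]
      split_ifs with h
      · rfl
      · exact hm n (by omega)
    rw [this]
    exact Submodule.sum_mem _ fun i _ => Submodule.smul_mem _ _ (Submodule.subset_span ⟨i, rfl⟩)
  have hE2 : ∀ w ∈ Submodule.span L E, ∃ m, ∀ n, m ≤ n → w n = 0 := by
    intro w hw
    induction hw using Submodule.span_induction with
    | mem x hx =>
      obtain ⟨k, rfl⟩ := hx
      exact ⟨k+1, fun n hn => by simp [Pi.single_apply]; omega⟩
    | zero => exact ⟨0, fun _ _ => rfl⟩
    | add x y _ _ hx hy =>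
      obtain ⟨a, ha⟩ := hx
      obtain ⟨b, hb⟩ := hy
      exact ⟨a + b, fun n hn => by simp [ha n (by omega), hb n (by omega)]⟩
    | smul c x _ hx =>
      obtain ⟨a, ha⟩ := hx
      exact ⟨a, fun n hn => by simp [ha n hn]⟩
  have hSu : ∀ ξ, S ξ (fun η => v η) = (insert θ E ∪ u '' Iio ξ) ∪ (fun η : I => η.1 (v η)) '' Iio ξ := by
    intro ξ
    simp only [S, u, image_eq_range]
  have hu : ∀ ξ, u ξ ∉ Submodule.span L ((insert θ E ∪ u '' Iio ξ) ∪ (fun η : I => η.1 (v η)) '' Iio ξ) := by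
    intro ξ; rw [← hSu]; exact (hv ξ).1
  have hTu : ∀ ξ (g : L), ξ.1 (v ξ) - g • u ξ ∉ Submodule.span L ((insert θ E ∪ u '' Iio ξ) ∪ (fun η : I => η.1 (v η)) '' Iio ξ) := by
    intro ξ; rw [← hSu]; exact (hv ξ).2
  refine ⟨Submodule.span L (E ∪ u '' univ), fun w hw => Submodule.span_mono subset_union_left (hE w hw), ?_, ?_⟩
  · intro h
    rcases exchange E u univ θ h with h | ⟨ξ, _, h⟩
    · obtain ⟨m, hm⟩ := hE2 _ h
      exact hθ m (hm m le_rfl)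
    · apply hu ξ
      refine Submodule.span_mono ?_ h
      rw [← insert_union]
      exact subset_union_left
  · intro T hT hK
    apply good_of_not_bad ρ T hT
    intro hb
    let ξ : I := ⟨T, hT, hb⟩
    have h1 : T (v ξ) ∈ Submodule.span L (E ∪ u '' univ) :=
      hK _ (Submodule.subset_span (Or.inr ⟨ξ, trivial, rfl⟩))
    have h2 : T (v ξ) ∈ Submodule.span L ((E ∪ u '' Iic ξ) ∪ u '' Ioi ξ) := by
      rw [union_assoc, ← image_union, Iic_union_Ioi]; exact h1
    rcases exchange _ u _ _ h2 with h | ⟨η, hη, h⟩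
    · have : E ∪ u '' Iic ξ = insert (u ξ) (E ∪ u '' Iio ξ) := by
        rw [← Iio_insert, image_insert_eq, union_insert]
      rw [this, Submodule.mem_span_insert] at h
      obtain ⟨g, z, hz, hg⟩ := h
      apply hTu ξ g
      have : (ξ.1 (v ξ) : ℕ → L) = T (v ξ) := rfl
      rw [this, hg, add_sub_cancel_left]
      refine Submodule.span_mono ?_ hz
      exact (union_subset_union_left _ (subset_insert _ _)).trans subset_union_left
    · apply hu η
      refine Submodule.span_mono ?_ h
      refine insert_subset (Or.inr ⟨ξ, hη, rfl⟩) ?_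
      refine Subset.trans ?_ subset_union_left
      rintro y ((hy | ⟨i, hi, rfl⟩) | hy)
      · exact Or.inl (Or.inr hy)
      · exact Or.inr ⟨i, lt_of_le_of_lt hi hη, rfl⟩
      · exact Or.inr hy
end generic2

section grp
variable {L : Type} [Field L] (ρ : ℤ[X] →+* L) (K : Submodule L (ℕ → L))

/-- The ambient group of sequences which become divisible enough after multiplying by `2 ^ k`. -/
noncomputable def H0 : AddSubgroup N where
  carrier := {h | ∃ k : ℕ, ∀ n, (2 : ℤ[X]) ^ (n+1) ∣ 2 ^ k * h n}
  zero_mem' := ⟨0, fun n => by simp⟩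
  add_mem' := by
    rintro a b ⟨k, hk⟩ ⟨l, hl⟩
    refine ⟨k + l, fun n => ?_⟩
    have : (2 : ℤ[X]) ^ (k+l) * (a + b) n = 2 ^ l * (2 ^ k * a n) + 2 ^ k * (2 ^ l * b n) := by
      rw [Pi.add_apply]; ring
    rw [this]
    exact dvd_add ((hk n).mul_left _) ((hl n).mul_left _)
  neg_mem' := by
    rintro a ⟨k, hk⟩
    exact ⟨k, fun n => by rw [Pi.neg_apply, mul_neg, dvd_neg]; exact hk n⟩

/-- multiplication by `2^(n+1)` in coordinate `n` -/
noncomputable def iota : N →+ H0 where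
  toFun x := ⟨fun n => 2 ^ (n+1) * x n, 0, fun n => by simp⟩
  map_zero' := by ext1; funext n; simp
  map_add' x y := by ext1; funext n; simp [mul_add]

lemma iota_apply (x : N) (n : ℕ) : (iota x).1 n = 2 ^ (n+1) * x n := rfl

lemma iota_inj {x y : N} (h : iota x = iota y) : x = y := by
  funext n
  have := congrArg (fun z : H0 => z.1 n) h
  simp only [iota_apply] at this
  exact mul_left_cancel₀ (pow_ne_zero _ two_ne_zero) this

noncomputable def half : N →+ H0 where
  toFun x := ⟨fun n => 2 ^ n * x n, 1, fun n => ⟨x n, by ring⟩⟩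
  map_zero' := by ext1; funext n; simp
  map_add' x y := by ext1; funext n; simp [mul_add]

lemma half_apply (x : N) (n : ℕ) : (half x).1 n = 2 ^ n * x n := rfl

noncomputable def deep (m : ℕ) (x : N) : H0 :=
  ⟨fun n => 2 ^ (n - m) * x n, m + 1, fun n => by
    have : (2 : ℤ[X]) ^ (m+1) * (2 ^ (n-m) * x n) = 2 ^ (n+1) * (2 ^ (m + 1 + (n - m) - (n+1)) * x n) := by
      rw [← mul_assoc, ← mul_assoc, ← pow_add, ← pow_add]; congr 2; omega
    exact ⟨_, this⟩⟩

lemma deep_apply (m : ℕ) (x : N) (n : ℕ) : (deep m x).1 n = 2 ^ (n - m) * x n := rfl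

lemma two_pow_deep (m : ℕ) (x : N) (hx : ∀ n < m, x n = 0) : (2 ^ m) • deep m x = half x := by
  ext1; funext n
  rw [AddSubgroup.coe_nsmul, Pi.smul_apply, deep_apply, half_apply, nsmul_eq_mul]
  by_cases h : n < m
  · rw [hx n h]; simp
  · push_cast
    rw [← mul_assoc, ← pow_add]; congr 2; omega

lemma two_half (x : N) : 2 • half x = iota x := by
  ext1; funext n
  rw [AddSubgroup.coe_nsmul, Pi.smul_apply, half_apply, iota_apply, nsmul_eq_mul]
  push_cast; ring

noncomputable def K0 : AddSubgroup H0 := (K.toAddSubgroup.comap (red ρ)).map iota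

abbrev GG : Type := H0 ⧸ K0 ρ K

noncomputable def aa : N →+ GG ρ K := (QuotientAddGroup.mk' (K0 ρ K)).comp iota

lemma aa_apply (x : N) : aa ρ K x = QuotientAddGroup.mk' (K0 ρ K) (iota x) := rfl

lemma aa_eq_zero (x : N) : aa ρ K x = 0 ↔ red ρ x ∈ K := by
  rw [aa_apply, QuotientAddGroup.mk'_apply, QuotientAddGroup.eq_zero_iff]
  constructor
  · rintro ⟨y, hy, h⟩
    rw [← iota_inj h]; exact hy
  · intro h; exact ⟨x, h, rfl⟩

lemma aa_eq (x y : N) : aa ρ K x = aa ρ K y ↔ red ρ x - red ρ y ∈ K := by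
  rw [← sub_eq_zero, ← map_sub, aa_eq_zero, map_sub]

lemma mk_eq (h h' : H0) (e : QuotientAddGroup.mk' (K0 ρ K) h = QuotientAddGroup.mk' (K0 ρ K) h') :
    ∃ u : N, ∀ n, h.1 n = h'.1 n + 2 ^ (n+1) * u n := by
  rw [← sub_eq_zero, ← map_sub, QuotientAddGroup.mk'_apply, QuotientAddGroup.eq_zero_iff] at e
  obtain ⟨u, _, hu⟩ := e
  refine ⟨u, fun n => ?_⟩
  have : (iota u).1 n = h.1 n - h'.1 n := by rw [hu]; rfl
  rw [← iota_apply, this]; ring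

lemma isP (h2 : (2 : L) = 0) (g : GG ρ K) : ∃ n : ℕ, 2 ^ n • g = 0 := by
  obtain ⟨h, rfl⟩ := QuotientAddGroup.mk'_surjective _ g
  obtain ⟨k, hk⟩ := h.2
  choose u hu using hk
  refine ⟨k + 1, ?_⟩
  have : (2 ^ (k+1)) • h = iota ((2 : ℕ) • u) := by
    ext1; funext n
    rw [AddSubgroup.coe_nsmul, Pi.smul_apply, iota_apply, Pi.smul_apply, nsmul_eq_mul, nsmul_eq_mul]
    push_cast
    rw [pow_succ]
    linear_combination 2 * hu n
  rw [← map_nsmul, this, ← aa_apply, aa_eq_zero, map_nsmul]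
  have : (2 : ℕ) • red ρ u = 0 := by
    funext n; rw [Pi.smul_apply, nsmul_eq_mul]; push_cast; rw [h2]; simp
  rw [this]; exact K.zero_mem

lemma endo_T (h2 : (2 : L) = 0) (hfin : ∀ v : ℕ → L, (∃ m, ∀ n, m ≤ n → v n = 0) → v ∈ K)
    (φ : GG ρ K →+ GG ρ K) :
    ∃ (T : N →+ (ℕ → L)) (T0 : N → N), (∀ x, T x = red ρ (T0 x)) ∧ Filt T ∧
      ∀ x, φ (aa ρ K x) = aa ρ K (T0 x) := by
  have hs : ∀ g : GG ρ K, ∃ h, QuotientAddGroup.mk' (K0 ρ K) h = g := QuotientAddGroup.mk'_surjective _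
  choose r hr using hs
  let mk := QuotientAddGroup.mk' (K0 ρ K)
  let z : N → H0 := fun x => r (φ (mk (half x)))
  have hz : ∀ x, mk (z x) = φ (mk (half x)) := fun x => hr _
  have hz2 : ∀ x, mk (2 • z x) = φ (aa ρ K x) := fun x => by
    rw [map_nsmul, hz, ← map_nsmul φ, ← map_nsmul mk, two_half]; rfl
  have hfilt : ∀ m x, (∀ n < m, x n = 0) → ∃ (z' : H0) (u : N),
      ∀ n, (z x).1 n = 2 ^ m * z'.1 n + 2 ^ (n+1) * u n := by
    intro m x hx
    let z' := r (φ (mk (deep m x)))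
    refine ⟨z', ?_⟩
    have : mk (z x) = mk (2 ^ m • z') := by
      rw [hz, ← two_pow_deep m x hx, map_nsmul, map_nsmul, map_nsmul]
      congr 1
      exact (hr _).symm
    obtain ⟨u, hu⟩ := mk_eq ρ K _ _ this
    refine ⟨u, fun n => ?_⟩
    rw [hu n, AddSubgroup.coe_nsmul, Pi.smul_apply, nsmul_eq_mul]
    push_cast; rfl
  have hdiv : ∀ x n, ∃ c, (z x).1 n = 2 ^ n * c := by
    intro x n
    let lo : N := fun k => if k < n then x k else 0
    have hlo : aa ρ K lo = 0 := by
      rw [aa_eq_zero]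
      exact hfin _ ⟨n, fun k hk => by simp [lo, not_lt.2 hk]⟩
    have hhi : ∀ k < n, (x - lo) k = 0 := fun k hk => by simp [lo, hk]
    have e : mk (2 • z x) = mk (2 • z (x - lo)) := by
      rw [hz2, hz2, map_sub (aa ρ K), hlo, sub_zero]
    obtain ⟨u, hu⟩ := mk_eq ρ K _ _ e
    obtain ⟨z', u', hu'⟩ := hfilt n _ hhi
    refine ⟨z'.1 n + 2 * u' n + u n, ?_⟩
    have h1 := hu n
    rw [AddSubgroup.coe_nsmul, Pi.smul_apply, AddSubgroup.coe_nsmul, Pi.smul_apply, hu' n,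
      nsmul_eq_mul, nsmul_eq_mul] at h1
    push_cast at h1
    apply mul_left_cancel₀ (two_ne_zero (α := ℤ[X]))
    rw [h1]; ring
  choose T0 hT0 using hdiv
  have h2r : ∀ c : ℤ[X], ρ (2 * c) = 0 := fun c => by
    rw [map_mul, map_ofNat, h2, zero_mul]
  have hadd : ∀ x y, red ρ (T0 (x + y)) = red ρ (T0 x) + red ρ (T0 y) := by
    intro x y
    have e : mk (z (x + y)) = mk (z x + z y) := by
      rw [map_add, hz, hz, hz, map_add, map_add, map_add]
    obtain ⟨u, hu⟩ := mk_eq ρ K _ _ e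
    funext n
    have h1 := hu n
    rw [AddSubgroup.coe_add, Pi.add_apply, hT0, hT0, hT0] at h1
    have h3 : T0 (x + y) n = T0 x n + T0 y n + 2 * u n := by
      apply mul_left_cancel₀ (pow_ne_zero n (two_ne_zero (α := ℤ[X])))
      rw [h1]; ring
    rw [Pi.add_apply, red_apply, red_apply, red_apply, h3, map_add, map_add, h2r, add_zero]
  refine ⟨AddMonoidHom.mk' (fun x => red ρ (T0 x)) hadd, T0, fun x => rfl, ?_, ?_⟩
  · intro m x hx n hn
    obtain ⟨z', u, hu⟩ := hfilt m x hx
    have h1 := hu n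
    rw [hT0] at h1
    have h3 : T0 x n = 2 * (2 ^ (m - n - 1) * z'.1 n + u n) := by
      apply mul_left_cancel₀ (pow_ne_zero n (two_ne_zero (α := ℤ[X])))
      rw [h1]
      have : (2 : ℤ[X]) ^ m = 2 ^ n * 2 * 2 ^ (m - n - 1) := by
        rw [← pow_succ, ← pow_add]; congr 1; omega
      rw [this]; ring
    change ρ (T0 x n) = 0
    rw [h3, h2r]
  · intro x
    have : iota (T0 x) = 2 • z x := by
      ext1; funext n
      rw [AddSubgroup.coe_nsmul, Pi.smul_apply, hT0, iota_apply, nsmul_eq_mul]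
      push_cast; ring
    rw [aa_apply ρ K (T0 x), this]
    exact (hz2 x).symm

/-- the conclusion on endomorphisms -/
lemma endo_poly (h2 : (2 : L) = 0) (hfin : ∀ v : ℕ → L, (∃ m, ∀ n, m ≤ n → v n = 0) → v ∈ K)
    (hK : ∀ T : N →+ (ℕ → L), Filt T → (∀ x, red ρ x ∈ K → T x ∈ K) →
        ∃ m, ∀ x : N, (∀ n < m, x n = 0) → T x = (T (Pi.single m 1) m) • red ρ x)
    (φ : GG ρ K →+ GG ρ K) :
    ∃ f : ℤ[X], ∀ x, ∃ x', φ (aa ρ K x) = aa ρ K x' ∧ red ρ x' - ρ f • red ρ x ∈ K := by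
  obtain ⟨T, T0, hT0, hF, hφ⟩ := endo_T ρ K h2 hfin φ
  have hTK : ∀ x, red ρ x ∈ K → T x ∈ K := by
    intro x hx
    rw [hT0, ← aa_eq_zero, ← hφ, (aa_eq_zero ρ K x).2 hx, map_zero]
  obtain ⟨m, hm⟩ := hK T hF hTK
  refine ⟨T0 (Pi.single m 1) m, fun x => ⟨T0 x, hφ x, ?_⟩⟩
  let lo : N := fun k => if k < m then x k else 0
  have hlo : red ρ lo ∈ K := hfin _ ⟨m, fun k hk => by simp [lo, not_lt.2 hk]⟩
  have hhi : ∀ k < m, (x - lo) k = 0 := fun k hk => by simp [lo, hk]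
  have e := hm _ hhi
  rw [← hT0]
  have : T x - ρ (T0 (Pi.single m 1) m) • red ρ x = T lo - ρ (T0 (Pi.single m 1) m) • red ρ lo := by
    rw [hT0 (Pi.single m 1), red_apply, map_sub, map_sub, smul_sub] at e
    rw [sub_eq_sub_iff_sub_eq_sub]
    exact e
  rw [this]
  exact K.sub_mem (hTK _ hlo) (K.smul_mem _ hlo)

noncomputable def mulX : N →+ N where
  toFun x n := X * x n
  map_zero' := by funext n; simp
  map_add' x y := by funext n; simp [mul_add]

noncomputable def mulXH : H0 →+ H0 where
  toFun h := ⟨fun n => X * h.1 n, by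
    obtain ⟨k, hk⟩ := h.2
    exact ⟨k, fun n => by rw [mul_left_comm]; exact (hk n).mul_left _⟩⟩
  map_zero' := by ext1; funext n; simp
  map_add' x y := by ext1; funext n; simp [mul_add]

lemma red_mulX (x : N) : red ρ (mulX x) = ρ X • red ρ x := by
  funext n; simp [mulX]

lemma exists_tau : ∃ τ : GG ρ K →+ GG ρ K, ∀ x, τ (aa ρ K x) = aa ρ K (mulX x) := by
  have hi : ∀ x, mulXH (iota x) = iota (mulX x) := fun x => by
    ext1; funext n
    change X * (2 ^ (n+1) * x n) = 2 ^ (n+1) * (X * x n)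
    ring
  refine ⟨QuotientAddGroup.map _ _ mulXH ?_, fun x => ?_⟩
  · rintro _ ⟨x, hx, rfl⟩
    refine ⟨mulX x, ?_, (hi x).symm⟩
    change red ρ (mulX x) ∈ K
    rw [red_mulX]; exact K.smul_mem _ hx
  · rw [aa_apply, aa_apply, ← hi]; rfl
end grp

section fin

abbrev F2 : Type := (ZMod 2)[X]
abbrev LL : Type := FractionRing (ZMod 2)[X]

noncomputable def rho : ℤ[X] →+* LL :=
  (algebraMap F2 LL).comp (Polynomial.mapRingHom (Int.castRingHom (ZMod 2)))

noncomputable def tt : LL := algebraMap F2 LL X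
noncomputable def ss : LL := tt⁻¹

lemma rho_X : rho X = tt := by simp [rho, tt]

lemma tt_ne : tt ≠ 0 := by
  rw [tt, Ne, FaithfulSMul.algebraMap_eq_zero_iff]; exact X_ne_zero

lemma ss_ne : ss ≠ 0 := inv_ne_zero tt_ne
lemma ts : tt * ss = 1 := mul_inv_cancel₀ tt_ne

lemma two_LL : (2 : LL) = 0 := by
  have h : (2 : F2) = 0 := CharTwo.two_eq_zero
  rw [← map_ofNat (algebraMap F2 LL), h, map_zero]

lemma eval_t (p : F2) : aeval tt p = algebraMap F2 LL p := by
  rw [tt, aeval_algebraMap_apply, aeval_X_left_apply]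

lemma rev (p : F2) : algebraMap F2 LL p = tt ^ p.natDegree * aeval ss p.reverse := by
  letI := invertibleOfNonzero tt_ne
  have := eval₂_reverse_mul_pow (algebraMap (ZMod 2) LL) tt p
  rw [invOf_eq_inv] at this
  rw [← eval_t, mul_comm]
  exact this.symm

lemma ev_inj (p : F2) (h : aeval ss p = 0) : p = 0 := by
  letI := invertibleOfNonzero ss_ne
  have := eval₂_reverse_mul_pow (algebraMap (ZMod 2) LL) ss p
  rw [invOf_eq_inv, ← aeval_def, ← aeval_def, h, ss, inv_inv, eval_t] at this
  rcases mul_eq_zero.1 this with h | h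
  · rw [FaithfulSMul.algebraMap_eq_zero_iff] at h
    exact reverse_eq_zero.1 h
  · exact absurd h (pow_ne_zero _ ss_ne)

noncomputable def theta : ℕ → LL := fun n => tt ^ n

instance : Infinite LL := Infinite.of_injective (algebraMap F2 LL) (FaithfulSMul.algebraMap_injective _ _)
instance : Countable LL := by
  rw [← mk_le_aleph0_iff, Cardinal.mk_fractionRing]
  exact Polynomial.cardinalMk_le_max.trans (by simp)

noncomputable def thN (m : ℕ) : N := fun n => if m ≤ n then X ^ (n - m) else 0

variable (K : Submodule LL (ℕ → LL))

lemma red_thN (hfin : ∀ v : ℕ → LL, (∃ m, ∀ n, m ≤ n → v n = 0) → v ∈ K) (m : ℕ) :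
    red rho (thN m) - ss ^ m • theta ∈ K := by
  refine hfin _ ⟨m, fun n hn => ?_⟩
  simp only [Pi.sub_apply, red_apply, thN, if_pos hn, Pi.smul_apply, theta, map_pow, rho_X, smul_eq_mul]
  obtain ⟨k, rfl⟩ := Nat.exists_eq_add_of_le hn
  rw [pow_add, ← mul_assoc, ← mul_pow, mul_comm ss, ts]
  simp

noncomputable def UU : AddSubgroup (ℕ → LL) where
  carrier := {v | ∃ p : F2, v - aeval ss p • theta ∈ K}
  zero_mem' := ⟨0, by simp⟩
  add_mem' := by
    rintro a b ⟨p, hp⟩ ⟨q, hq⟩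
    refine ⟨p + q, ?_⟩
    have := K.add_mem hp hq
    rw [map_add, add_smul]
    convert this using 1
    abel
  neg_mem' := by
    rintro a ⟨p, hp⟩
    refine ⟨-p, ?_⟩
    have := K.neg_mem hp
    rw [map_neg, neg_smul]
    convert this using 1
    abel

noncomputable def XX : AddSubgroup (GG rho K) := ((UU K).comap (red rho)).map (aa rho K)

lemma K_le_U {v : ℕ → LL} (h : v ∈ K) : v ∈ UU K := ⟨0, by simpa using h⟩

lemma mem_XX (x : N) : aa rho K x ∈ XX K ↔ red rho x ∈ UU K := by
  constructor
  · rintro ⟨y, hy, h⟩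
    rw [aa_eq] at h
    have h1 : red rho y ∈ UU K := hy
    have := (UU K).sub_mem h1 (K_le_U K h)
    rwa [sub_sub_cancel] at this
  · intro h; exact ⟨x, h, rfl⟩

lemma pigeon {G : Type} [AddCommGroup G] (A B : AddSubgroup G)
    (h : ((A ⊓ B).addSubgroupOf A).index ≠ 0) (f : ℕ → G) (hf : ∀ n, f n ∈ A) :
    ∃ m m', m < m' ∧ f m' - f m ∈ A ⊓ B := by
  haveI : ((A ⊓ B).addSubgroupOf A).FiniteIndex := ⟨h⟩
  haveI : Finite (A ⧸ (A ⊓ B).addSubgroupOf A) := AddSubgroup.finite_quotient_of_finiteIndex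
  obtain ⟨a, b, hne, hab⟩ := Finite.exists_ne_map_eq_of_infinite
    (fun n => (QuotientAddGroup.mk (⟨f n, hf n⟩ : A) : A ⧸ (A ⊓ B).addSubgroupOf A))
  rw [QuotientAddGroup.eq, AddSubgroup.mem_addSubgroupOf] at hab
  have hab' : f b - f a ∈ A ⊓ B := by
    have : ((-⟨f a, hf a⟩ + ⟨f b, hf b⟩ : A) : G) = f b - f a := by
      simp only [AddSubgroup.coe_add, NegMemClass.coe_neg]; abel
    rwa [this] at hab
  rcases lt_or_gt_of_ne hne with h | h
  · exact ⟨a, b, h, hab'⟩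
  · refine ⟨b, a, h, ?_⟩
    rw [← neg_sub]; exact neg_mem hab'

lemma not_comm (hfin : ∀ v : ℕ → LL, (∃ m, ∀ n, m ≤ n → v n = 0) → v ∈ K) (hθ : theta ∉ K)
    (Y : AddSubgroup (GG rho K))
    (hY : ∀ φ : GG rho K →+ GG rho K, AddSubgroup.map φ Y ≤ Y)
    (h1 : ((XX K ⊓ Y).addSubgroupOf (XX K)).index ≠ 0)
    (h2 : ((XX K ⊓ Y).addSubgroupOf Y).index ≠ 0) : False := by
  have hX : ∀ m, aa rho K (thN m) ∈ XX K := fun m => by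
    rw [mem_XX]
    exact ⟨X ^ m, by rw [map_pow, aeval_X]; exact red_thN K hfin m⟩
  obtain ⟨m, m', hm, hd⟩ := pigeon _ _ h1 _ hX
  obtain ⟨τ, hτ⟩ := exists_tau rho K
  rw [← map_sub] at hd
  set x0 := thN m' - thN m with hx0
  have hx0K : red rho x0 - (ss ^ m' - ss ^ m) • theta ∈ K := by
    have := K.sub_mem (red_thN K hfin m') (red_thN K hfin m)
    rw [hx0, map_sub, sub_smul]
    convert this using 1
    abel
  have hit : ∀ n, aa rho K (mulX^[n] x0) ∈ Y ∧ red rho (mulX^[n] x0) = tt ^ n • red rho x0 := by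
    intro n
    induction n with
    | zero => exact ⟨hd.2, by simp⟩
    | succ n ih =>
      rw [Function.iterate_succ_apply', red_mulX, ih.2, smul_smul, rho_X, pow_succ']
      refine ⟨?_, rfl⟩
      rw [← hτ]
      exact hY τ ⟨_, ih.1, rfl⟩
  rw [inf_comm] at h2
  obtain ⟨j, j', hj, hd2⟩ := pigeon _ _ h2 (fun j => aa rho K (mulX^[m + j] x0)) (fun j => (hit _).1)
  have hd3 : aa rho K (mulX^[m+j'] x0) - aa rho K (mulX^[m+j] x0) ∈ XX K := hd2.2
  rw [← map_sub, mem_XX, map_sub, (hit _).2, (hit _).2, ← sub_smul] at hd3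
  obtain ⟨p, hp⟩ := hd3
  have h4 : ((tt ^ (m + j') - tt ^ (m + j)) * (ss ^ m' - ss ^ m) - aeval ss p) • theta ∈ K := by
    have := K.sub_mem hp (K.smul_mem (tt ^ (m + j') - tt ^ (m + j)) hx0K)
    rw [sub_smul, mul_smul]
    convert this using 1
    rw [smul_sub]; abel
  have h5 : (tt ^ (m + j') - tt ^ (m + j)) * (ss ^ m' - ss ^ m) - aeval ss p = 0 := by
    by_contra h
    exact hθ ((K.smul_mem_iff h).1 h4)
  obtain ⟨a, rfl⟩ := Nat.exists_eq_add_of_lt hj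
  obtain ⟨b, rfl⟩ := Nat.exists_eq_add_of_lt hm
  have h6 : (1 - X ^ (a + 1) : F2) * (X ^ (m + b + 1) - X ^ m) - X ^ (m + (j + a + 1)) * p = 0 := by
    apply ev_inj
    simp only [map_sub, map_mul, map_one, map_pow, aeval_X]
    have e1 : ss ^ (m + (j + a + 1)) * tt ^ (m + (j + a + 1)) = 1 := by
      rw [← mul_pow, mul_comm, ts, one_pow]
    have e2 : ss ^ (m + j) * tt ^ (m + j) = 1 := by
      rw [← mul_pow, mul_comm, ts, one_pow]
    have e3 : ss ^ (m + (j + a + 1)) = ss ^ (m + j) * ss ^ (a + 1) := by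
      rw [← pow_add]; congr 1; omega
    linear_combination ss ^ (m + (j + a + 1)) * h5 - (ss ^ (m + b + 1) - ss ^ m) * e1
      + (ss ^ (m + b + 1) - ss ^ m) * ss ^ (a + 1) * e2
      + (ss ^ (m + b + 1) - ss ^ m) * tt ^ (m + j) * e3
  have h7 := congrArg (fun q : F2 => q.coeff m) h6
  have e : (1 - X ^ (a + 1) : F2) * (X ^ (m + b + 1) - X ^ m) = X ^ m * ((1 - X ^ (a+1)) * (X ^ (b+1) - 1)) := by
    ring
  simp only [e, coeff_sub, coeff_X_pow_mul', coeff_zero] at h7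
  rw [if_pos le_rfl, if_neg (by omega), Nat.sub_self, mul_coeff_zero] at h7
  simp at h7

lemma fully_inert (hfin : ∀ v : ℕ → LL, (∃ m, ∀ n, m ≤ n → v n = 0) → v ∈ K)
    (hK : ∀ T : N →+ (ℕ → LL), Filt T → (∀ x, red rho x ∈ K → T x ∈ K) →
        ∃ m, ∀ x : N, (∀ n < m, x n = 0) → T x = (T (Pi.single m 1) m) • red rho x)
    (φ : GG rho K →+ GG rho K) : Finite ((AddSubgroup.map φ (XX K)).map (QuotientAddGroup.mk' (XX K))) := by
  obtain ⟨f, hf⟩ := endo_poly rho K two_LL hfin hK φ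
  set f2 : F2 := Polynomial.mapRingHom (Int.castRingHom (ZMod 2)) f with hf2
  have hrf : rho f = tt ^ f2.natDegree * aeval ss f2.reverse := rev f2
  set d := f2.natDegree
  have key : ∀ g : (AddSubgroup.map φ (XX K)).map (QuotientAddGroup.mk' (XX K)),
      ∃ r : degreeLT (ZMod 2) d, ∃ x, g.1 = QuotientAddGroup.mk' (XX K) (aa rho K x) ∧
        red rho x - (tt ^ d * aeval ss r.1) • theta ∈ UU K := by
    rintro ⟨_, _, ⟨_, ⟨x, ⟨p, hp⟩, rfl⟩, rfl⟩, rfl⟩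
    obtain ⟨x', hx', hk⟩ := hf x
    have hmon : (X ^ d : F2).Monic := monic_X_pow d
    refine ⟨⟨(f2.reverse * p) %ₘ X ^ d, ?_⟩, x', congrArg (QuotientAddGroup.mk' (XX K)) hx', (f2.reverse * p) /ₘ X ^ d, ?_⟩
    · rw [mem_degreeLT]
      have := degree_modByMonic_lt (f2.reverse * p) hmon
      rwa [degree_X_pow] at this
    · have h1 := congrArg (aeval ss) (modByMonic_add_div (f2.reverse * p) (X ^ d))
      simp only [map_add, map_mul, map_pow, aeval_X] at h1
      have h2 : tt ^ d * aeval ss ((f2.reverse * p) %ₘ X ^ d) + aeval ss ((f2.reverse * p) /ₘ X ^ d)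
          = rho f * aeval ss p := by
        have e1 : tt ^ d * ss ^ d = 1 := by rw [← mul_pow, ts, one_pow]
        rw [hrf]
        linear_combination tt ^ d * h1 - aeval ss ((f2.reverse * p) /ₘ X ^ d) * e1
      have := K.add_mem hk (K.smul_mem (rho f) hp)
      rw [sub_sub, ← add_smul, h2]
      convert this using 1
      rw [smul_sub, smul_smul]; abel
  choose r x hx hr using key
  haveI : Finite (degreeLT (ZMod 2) d) := Finite.of_equiv _ (degreeLTEquiv (ZMod 2) d).toEquiv.symm
  refine Finite.of_injective r ?_
  intro g g' h
  apply Subtype.ext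
  rw [hx g, hx g']
  refine QuotientAddGroup.eq_iff_sub_mem.2 ?_
  rw [← map_sub, mem_XX, map_sub]
  have h1 := (UU K).sub_mem (hr g) (hr g')
  rw [h] at h1
  rwa [sub_sub_sub_cancel_right] at h1

lemma chara (hfin : ∀ v : ℕ → LL, (∃ m, ∀ n, m ≤ n → v n = 0) → v ∈ K) (hθ : theta ∉ K)
    (hK : ∀ T : N →+ (ℕ → LL), Filt T → (∀ x, red rho x ∈ K → T x ∈ K) →
        ∃ m, ∀ x : N, (∀ n < m, x n = 0) → T x = (T (Pi.single m 1) m) • red rho x)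
    (φ : GG rho K ≃+ GG rho K) : AddSubgroup.map φ.toAddMonoidHom (XX K) ≤ XX K := by
  obtain ⟨f, hf⟩ := endo_poly rho K two_LL hfin hK φ.toAddMonoidHom
  obtain ⟨g, hg⟩ := endo_poly rho K two_LL hfin hK φ.symm.toAddMonoidHom
  have h1 : rho f = 1 := by
    obtain ⟨x', hx', hk⟩ := hf (thN 0)
    obtain ⟨x'', hx'', hk'⟩ := hg x'
    have e : aa rho K x'' = aa rho K (thN 0) := by
      rw [← hx'', ← hx']; simp
    rw [aa_eq] at e
    have h0 := red_thN K hfin 0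
    rw [pow_zero, one_smul] at h0
    have h4 : (rho g * rho f - 1) • theta ∈ K := by
      have := K.sub_mem (K.sub_mem e hk') (K.add_mem (K.smul_mem (rho g) hk) (K.smul_mem (rho g * rho f - 1) h0))
      convert this using 1
      simp only [smul_sub, sub_smul, mul_smul, one_smul]
      abel
    have h5 : rho g * rho f - 1 = 0 := by
      by_contra h
      exact hθ ((K.smul_mem_iff h).1 h4)
    set f2 : F2 := Polynomial.mapRingHom (Int.castRingHom (ZMod 2)) f with hf2
    set g2 : F2 := Polynomial.mapRingHom (Int.castRingHom (ZMod 2)) g with hg2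
    have h6 : g2 * f2 = 1 := by
      apply FaithfulSMul.algebraMap_injective F2 LL
      rw [map_mul, map_one]
      exact sub_eq_zero.1 h5
    have hu : IsUnit f2 := IsUnit.of_mul_eq_one g2 (by rw [mul_comm]; exact h6)
    obtain ⟨c, hc, hcf⟩ := Polynomial.isUnit_iff.1 hu
    have hc1 : c = 1 := by
      have : ∀ c : ZMod 2, c ≠ 0 → c = 1 := by decide
      exact this c hc.ne_zero
    change algebraMap F2 LL f2 = 1
    rw [← hcf, hc1, map_one, map_one]
  rintro _ ⟨_, ⟨x, hx, rfl⟩, rfl⟩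
  obtain ⟨x', hx', hk⟩ := hf x
  change φ.toAddMonoidHom (aa rho K x) ∈ XX K
  rw [hx', mem_XX]
  rw [h1, one_smul] at hk
  have hx2 : red rho x ∈ UU K := hx
  have := (UU K).add_mem (K_le_U K hk) hx2
  rwa [sub_add_cancel] at this

end fin

end Ex

/-- Example 3.4: there is a `2`-group `G` with a characteristic, fully inert subgroup `X` that
is not commensurable with any fully invariant subgroup. -/
theorem stmt_19 :
    ∃ (G : Type) (_ : AddCommGroup G), IsPGroup' 2 G ∧
      ∃ X : AddSubgroup G, CharacteristicSub X ∧ FullyInertSub X ∧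
        ∀ Y : AddSubgroup G, FullyInvariantSub Y → ¬ Commens X Y := by
  obtain ⟨K, hfin, hθ, hK⟩ := Ex.exists_K Ex.rho Ex.theta (fun n => pow_ne_zero n Ex.tt_ne)
  refine ⟨Ex.GG Ex.rho K, inferInstance, fun x => Ex.isP Ex.rho K Ex.two_LL x, Ex.XX K, ?_, ?_, ?_⟩
  · exact fun φ => Ex.chara K hfin hθ hK φ
  · exact fun φ => Ex.fully_inert K hfin hK φ
  · exact fun Y hY hc => Ex.not_comm K hfin hθ Y hY hc.1 hc.2
end
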